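/- arXiv:1201.2883 — 2 statements merged into one kernel-verified Lean document; each statement's English description precedes it below -/
import Mathlib

section
/- Let g be a complete Riemannian metric without conjugate points on the cylinder C = S¹×ℝ. If γ : [0,∞) → C is a ray that converges to an end ℰ of C, and U ⊆ C is a neighborhood of ℰ, then l(γ(r)) ≤ H¹(U ∩ ∂B(γ(0),r)) for every sufficiently large r > 0. -/
open MeasureTheory Filter Set Real
open scoped ENNReal NNReal

noncomputable section

/-- Points / tangent vectors of the plane. -/
abbrev V2 : Type := Fin 2 → ℝ

/-- Componentwise velocity of a curve in the plane. -/
def vel (γ : ℝ → V2) (t : ℝ) : V2 := fun k => deriv (fun s => γ s k) t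

/-- Componentwise acceleration of a curve in the plane. -/
def acc (γ : ℝ → V2) (t : ℝ) : V2 := fun k => deriv (fun s => vel γ s k) t

/-- The deck transformation `τⁿ(x,y) = (x+n,y)`. -/
def shift (n : ℤ) (p : V2) : V2 := p + (n : ℝ) • (Pi.single 0 1 : V2)

/-- A (smooth) Riemannian metric on the plane ℝ²: a smooth family of
positive-definite symmetric matrices. -/
structure RMetric where
  g : V2 → Matrix (Fin 2) (Fin 2) ℝ
  smooth : ∀ i j, ContDiff ℝ (⊤ : ℕ∞) fun p => g p i j
  symm : ∀ p, (g p).IsSymm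
  posDef : ∀ p, (g p).PosDef

/-- `B` has tangent direction `τ` at `p`. -/
def TangentDirAt (B : Set V2) (p τ : V2) : Prop :=
  τ ≠ 0 ∧ ∀ ε > 0, ∃ δ > 0, ∀ q ∈ B, q ≠ p → ‖q - p‖ < δ →
    ∃ s : ℝ, ‖q - p - s • τ‖ ≤ ε * ‖q - p‖

/-- `B` is, near `x`, after a bi-Lipschitz change of coordinates, the graph of a
Lipschitz function. -/
def IsLipGraphAt (B : Set V2) (x : V2) : Prop :=
  ∃ U : Set V2, IsOpen U ∧ x ∈ U ∧
    ∃ (φ : V2 → ℝ × ℝ) (ψ : ℝ × ℝ → V2) (L : NNReal) (f : ℝ → ℝ),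
      LipschitzOnWith L φ U ∧ LipschitzOnWith L ψ (φ '' U) ∧
      (∀ y ∈ U, ψ (φ y) = y) ∧ LipschitzWith L f ∧
      ∀ y ∈ U, (y ∈ B ↔ (φ y).2 = f (φ y).1)

/-- A (compact) 1-dimensional strong Lipschitz submanifold of the plane. -/
def IsStrongLipschitzCurve (B : Set V2) : Prop := ∀ x ∈ B, IsLipGraphAt B x

/-- `Q` is the closure of its interior and its boundary `Q \ int Q` is a
1-dimensional strong Lipschitz submanifold. -/
def HasStrongLipschitzBoundary (Q : Set V2) : Prop :=
  Q = closure (interior Q) ∧ IsStrongLipschitzCurve (Q \ interior Q)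

/-- Absolute continuity of `F` on `[a,b]`. -/
def AbsContOn (F : ℝ → ℝ) (a b : ℝ) : Prop :=
  ∀ ε > 0, ∃ δ > 0, ∀ n : ℕ, ∀ I : Fin n → ℝ × ℝ,
    (∀ i, a ≤ (I i).1 ∧ (I i).1 ≤ (I i).2 ∧ (I i).2 ≤ b) →
    (∀ i j, i ≠ j → Disjoint (Set.Ioo (I i).1 (I i).2) (Set.Ioo (I j).1 (I j).2)) →
    (∑ i, ((I i).2 - (I i).1)) < δ → (∑ i, |F (I i).2 - F (I i).1|) < ε

/-- Local absolute continuity on a set: absolute continuity on every compact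
subinterval. -/
def LocAbsContOn (F : ℝ → ℝ) (s : Set ℝ) : Prop :=
  ∀ a ∈ s, ∀ b ∈ s, a ≤ b → AbsContOn F a b

namespace RMetric

variable (M : RMetric)

/-- The inner product `g_p(v,w)`. -/
def met (p v w : V2) : ℝ := ∑ i, ∑ j, M.g p i j * v i * w j

/-- The unit tangent bundle `T¹ = {(p,v) : g_p(v,v) = 1}`. -/
def UnitTangent : Set (V2 × V2) := {x | M.met x.1 x.2 x.2 = 1}

/-- Riemannian length of a `C¹` curve. -/
def curveLen (γ : ℝ → V2) (a b : ℝ) : ℝ :=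
  ∫ t in a..b, Real.sqrt (M.met (γ t) (vel γ t) (vel γ t))

/-- The Riemannian distance: infimum of lengths of `C¹` curves joining the points. -/
def dist (p q : V2) : ℝ :=
  sInf {L | ∃ γ : ℝ → V2, ContDiff ℝ 1 γ ∧ γ 0 = p ∧ γ 1 = q ∧ L = M.curveLen γ 0 1}

/-- Completeness of the induced metric space. -/
def Complete : Prop :=
  ∀ u : ℕ → V2, (∀ ε > 0, ∃ N, ∀ m ≥ N, ∀ n ≥ N, M.dist (u m) (u n) < ε) →
    ∃ p, Tendsto (fun n => M.dist (u n) p) atTop (nhds 0)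

/-- Open metric ball. -/
def ball (p : V2) (r : ℝ) : Set V2 := {q | M.dist p q < r}

/-- Metric sphere. -/
def sphere (p : V2) (r : ℝ) : Set V2 := {q | M.dist p q = r}

/-- Coordinate derivative `∂_d g_{ij}`. -/
def dg (d i j : Fin 2) (p : V2) : ℝ :=
  deriv (fun s : ℝ => M.g (p + s • (Pi.single d 1 : V2)) i j) 0

/-- Christoffel symbols `Γ^k_{ij}`. -/
def Γ (k i j : Fin 2) (p : V2) : ℝ :=
  (1 / 2) * ∑ l, (M.g p)⁻¹ k l * (M.dg i j l p + M.dg j i l p - M.dg l i j p)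

/-- Coordinate derivative `∂_d Γ^k_{ij}`. -/
def dΓ (d k i j : Fin 2) (p : V2) : ℝ :=
  deriv (fun s : ℝ => M.Γ k i j (p + s • (Pi.single d 1 : V2))) 0

/-- Gaussian curvature `K = R_{1212} / det g`. -/
def K (p : V2) : ℝ :=
  (∑ l, M.g p 0 l *
      (M.dΓ 0 l 1 1 p - M.dΓ 1 l 0 1 p +
        ∑ m, (M.Γ l 0 m p * M.Γ m 1 1 p - M.Γ l 1 m p * M.Γ m 0 1 p))) /
    (M.g p).det

/-- Flatness: vanishing Gaussian curvature. -/
def Flat : Prop := ∀ p, M.K p = 0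

/-- A geodesic of `g`: a `C²` solution of the geodesic equation. -/
def IsGeodesic (γ : ℝ → V2) : Prop :=
  ContDiff ℝ 2 γ ∧
    ∀ t, ∀ k, acc γ t k + ∑ i, ∑ j, M.Γ k i j (γ t) * vel γ t i * vel γ t j = 0

/-- Unit-speed curve. -/
def UnitSpeed (γ : ℝ → V2) : Prop := ∀ t, M.met (γ t) (vel γ t) (vel γ t) = 1

/-- No conjugate points: every nontrivial solution of the Jacobi equation along a
unit-speed geodesic vanishing at `a` vanishes nowhere else. -/
def NoConjugatePoints : Prop :=
  ∀ γ : ℝ → V2, M.IsGeodesic γ → M.UnitSpeed γ →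
    ∀ J : ℝ → ℝ, ContDiff ℝ 2 J →
      (∀ t, deriv (deriv J) t + M.K (γ t) * J t = 0) →
      (∃ t₀, J t₀ ≠ 0) → ∀ a, J a = 0 → ∀ t, t ≠ a → J t ≠ 0

/-- Riemannian area measure: density `√(det g)` with respect to Lebesgue measure. -/
def area : Measure V2 := volume.withDensity fun p => ENNReal.ofReal (Real.sqrt (M.g p).det)

/-- `Φ` is the geodesic flow of `g` on the unit tangent bundle. -/
def IsGeodesicFlow (Φ : V2 × V2 → ℝ → V2 × V2) : Prop :=
  ∀ x ∈ M.UnitTangent, Φ x 0 = x ∧ M.IsGeodesic (fun t => (Φ x t).1) ∧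
    ∀ t : ℝ, (Φ x t).2 = vel (fun s => (Φ x s).1) t

/-- First vector of the Gram-Schmidt `g`-orthonormal frame. -/
def E1 (p : V2) : V2 :=
  (Real.sqrt (M.met p (Pi.single 0 1) (Pi.single 0 1)))⁻¹ • (Pi.single 0 1 : V2)

def w2 (p : V2) : V2 :=
  (Pi.single 1 1 : V2) - (M.met p (Pi.single 1 1) (M.E1 p)) • M.E1 p

/-- Second vector of the Gram-Schmidt `g`-orthonormal frame. -/
def E2 (p : V2) : V2 := (Real.sqrt (M.met p (M.w2 p) (M.w2 p)))⁻¹ • M.w2 p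

/-- The `g`-unit tangent vector at `p` of angle `θ` (arclength parametrization of
the `g_p`-unit circle). -/
def unitVec (p : V2) (θ : ℝ) : V2 := Real.cos θ • M.E1 p + Real.sin θ • M.E2 p

/-- The Liouville measure on the unit tangent bundle: locally the product of the
area measure with the arclength (angle) measure on the fibers; `σ_* μ = 2π A`. -/
def liouville : Measure (V2 × V2) :=
  Measure.map (fun x : V2 × ℝ => (x.1, M.unitVec x.1 x.2))
    (M.area.prod (volume.restrict (Set.Ico 0 (2 * π))))

/-- Diameter with respect to the Riemannian distance. -/
def ediam (S : Set V2) : ℝ≥0∞ := ⨆ p ∈ S, ⨆ q ∈ S, ENNReal.ofReal (M.dist p q)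

/-- 1-dimensional Hausdorff measure (as an outer-measure set function) with
respect to the Riemannian distance. -/
def H1 (S : Set V2) : ℝ≥0∞ :=
  ⨆ (δ : ℝ) (_ : 0 < δ),
    ⨅ (U : ℕ → Set V2) (_ : S ⊆ ⋃ n, U n) (_ : ∀ n, M.ediam (U n) ≤ ENNReal.ofReal δ),
      ∑' n, M.ediam (U n)

/-- The "tube" in the unit tangent bundle over `S` with angles in `Θ`. -/
def tube (S : Set V2) (Θ : Set ℝ) : Set (V2 × V2) :=
  (fun x : V2 × ℝ => (x.1, M.unitVec x.1 x.2)) '' (S ×ˢ Θ)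

/-- `ν` is the measure on `σ⁻¹(B)` which is locally the product of the
1-dimensional Hausdorff measure on `B` with the angle measure on the fibers. -/
def IsNuOn (B : Set V2) (ν : Measure (V2 × V2)) : Prop :=
  ν {x : V2 × V2 | x.1 ∉ B} = 0 ∧
    ∀ S : Set V2, ∀ Θ : Set ℝ, S ⊆ B → MeasurableSet Θ → Θ ⊆ Set.Ico 0 (2 * π) →
      ν (M.tube S Θ) = M.H1 S * volume Θ

/-- Locally bounded function on the unit tangent bundle. -/
def LocBddUT (f : V2 × V2 → ℝ) : Prop :=
  ∀ R : ℝ, ∃ Cb : ℝ, ∀ x ∈ M.UnitTangent, ‖x.1‖ ≤ R → |f x| ≤ Cb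

/-- Locally bounded function on `T¹ × ℝ`. -/
def LocBddHopf (u : (V2 × V2) × ℝ → ℝ) : Prop :=
  ∀ R : ℝ, ∃ Cb : ℝ, ∀ x ∈ M.UnitTangent, ‖x.1‖ ≤ R → ∀ t : ℝ, |t| ≤ R → |u (x, t)| ≤ Cb

/-- The function `u` produced by E. Hopf's construction: Borel measurable, locally
bounded, solving the Riccati equation along every unit-speed geodesic, and
invariant under the geodesic flow. -/
def IsHopfSolution (Φ : V2 × V2 → ℝ → V2 × V2) (u : (V2 × V2) × ℝ → ℝ) : Prop :=
  Measurable u ∧ M.LocBddHopf u ∧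
    (∀ x ∈ M.UnitTangent, ∀ t : ℝ,
      HasDerivAt (fun s => u (x, s)) (-(u (x, t)) ^ 2 - M.K ((Φ x t).1)) t) ∧
    ∀ x ∈ M.UnitTangent, ∀ s t : ℝ, u (x, s + t) = u (Φ x s, t)

/-- `n` is the inner (w.r.t. `Q`) unit normal of the curve `B` at `p`. -/
def IsInnerUnitNormalAt (Q B : Set V2) (p n : V2) : Prop :=
  M.met p n n = 1 ∧ (∃ τ, TangentDirAt B p τ ∧ M.met p n τ = 0) ∧
    ∀ᶠ t in nhdsWithin (0 : ℝ) (Set.Ioi 0), p + t • n ∈ interior Q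

end RMetric

/-- A Riemannian metric on the cylinder `C = S¹ × ℝ`, modeled by a metric on ℝ²
invariant under the translation `τ(x,y) = (x+1,y)`. -/
structure CylMetric where
  M : RMetric
  invariant : ∀ p, M.g (shift 1 p) = M.g p

/-- τ-invariant subsets of ℝ², i.e. subsets of the cylinder. -/
def InvSet (S : Set V2) : Prop := ∀ p, p ∈ S ↔ shift 1 p ∈ S

/-- The fundamental strip `[0,1) × ℝ`. -/
def strip : Set V2 := {p : V2 | p 0 ∈ Set.Ico (0 : ℝ) 1}

namespace CylMetric

variable (C : CylMetric)

/-- The distance on the cylinder: `d(p,q) = min_n d̃(p̃, τⁿ q̃)`. -/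
def cdist (p q : V2) : ℝ := ⨅ n : ℤ, C.M.dist p (shift n q)

/-- Metric ball in the cylinder. -/
def cball (p : V2) (r : ℝ) : Set V2 := {q | C.cdist p q < r}

/-- Metric sphere in the cylinder. -/
def csphere (p : V2) (r : ℝ) : Set V2 := {q | C.cdist p q = r}

/-- Completeness of the cylinder. -/
def Complete : Prop :=
  ∀ u : ℕ → V2, (∀ ε > 0, ∃ N, ∀ m ≥ N, ∀ n ≥ N, C.cdist (u m) (u n) < ε) →
    ∃ p, Tendsto (fun n => C.cdist (u n) p) atTop (nhds 0)

/-- Area measure on the cylinder, computed in the fundamental strip. -/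
def carea (S : Set V2) : ℝ≥0∞ := C.M.area (S ∩ strip)

/-- The length `l(p)` of a shortest non-contractible loop based at `p`:
`l(p) = min_{n ≠ 0} d̃(p̃, τⁿ p̃)`. -/
def loopLen (p : V2) : ℝ := ⨅ n : {n : ℤ // n ≠ 0}, C.M.dist p (shift n.1 p)

/-- Diameter with respect to the cylinder distance. -/
def ediamC (S : Set V2) : ℝ≥0∞ := ⨆ p ∈ S, ⨆ q ∈ S, ENNReal.ofReal (C.cdist p q)

/-- 1-dimensional Hausdorff measure of a (τ-invariant) subset of the cylinder. -/
def cH1 (S : Set V2) : ℝ≥0∞ :=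
  ⨆ (δ : ℝ) (_ : 0 < δ),
    ⨅ (U : ℕ → Set V2) (_ : S ∩ strip ⊆ ⋃ n, U n)
      (_ : ∀ n, C.ediamC (U n) ≤ ENNReal.ofReal δ),
      ∑' n, C.ediamC (U n)

/-- Distance from a point to a set in the cylinder. -/
def cinfDist (p : V2) (S : Set V2) : ℝ := ⨅ q : S, C.cdist p (q : V2)

/-- A neighborhood of the end `ℰ₊` (`pos = true`) resp. `ℰ₋` (`pos = false`). -/
def EndNbhd (U : Set V2) (pos : Bool) : Prop :=
  InvSet U ∧ ∃ c : ℝ, 0 < c ∧ ∀ p : V2, (if pos then c < p 1 else p 1 < -c) → p ∈ U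

/-- The end has subquadratic area growth. -/
def Subquadratic (pos : Bool) : Prop :=
  ∃ U : Set V2, EndNbhd U pos ∧ ∃ p : V2,
    Filter.liminf (fun r : ℝ => C.carea (U ∩ C.cball p r) / ENNReal.ofReal (r ^ 2)) atTop = 0

/-- A sequence converging to the end `ℰ₊` resp. `ℰ₋`. -/
def TendstoEnd (p : ℕ → V2) (pos : Bool) : Prop :=
  Tendsto (fun i => p i 1) atTop (if pos then atTop else atBot)

/-- The end opens less than linearly. -/
def OpensLessThanLinearly (pos : Bool) : Prop :=
  ∃ p : ℕ → V2, TendstoEnd p pos ∧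
    Tendsto (fun i => C.loopLen (p i) / C.cdist (p i) (p 0)) atTop (nhds 0)

/-- A ray in the cylinder. -/
def IsRay (γ : ℝ → V2) : Prop := ∀ s ≥ (0:ℝ), ∀ t ≥ (0:ℝ), C.cdist (γ s) (γ t) = |s - t|

/-- A ray converging to the end `ℰ₊` resp. `ℰ₋`. -/
def RayToEnd (γ : ℝ → V2) (pos : Bool) : Prop :=
  C.IsRay γ ∧ Tendsto (fun t => γ t 1) atTop (if pos then atTop else atBot)

/-- A minimal geodesic line in the cylinder. -/
def IsMinimalLine (γ : ℝ → V2) : Prop :=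
  C.M.IsGeodesic γ ∧ ∀ s t : ℝ, C.cdist (γ s) (γ t) = |s - t|

/-- The line joins the two ends of the cylinder. -/
def JoinsEnds (γ : ℝ → V2) : Prop :=
  Tendsto (fun t : ℝ => γ t 1) atTop atTop ∧ Tendsto (fun t : ℝ => γ t 1) atBot atBot

/-- `b` is the Busemann function of the ray `γ`: `b(p) = lim_t (d(p,γ(t)) - t)`. -/
def IsBusemann (γ : ℝ → V2) (b : V2 → ℝ) : Prop :=
  ∀ p : V2, Tendsto (fun t : ℝ => C.cdist p (γ t) - t) atTop (nhds (b p))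

end CylMetric

end

/-- The radial projection of a nonzero complex number to the unit circle. -/
noncomputable def unitCircleProj (z : {z : ℂ // z ≠ 0}) : Circle :=
  ⟨z.1 / ‖z.1‖, by
    have : ‖z.1‖ ≠ 0 := norm_ne_zero_iff.2 z.2
    simp [Submonoid.unitSphere, this]⟩

theorem continuous_unitCircleProj : Continuous unitCircleProj := by
  refine Continuous.subtype_mk ?_ _
  refine continuous_subtype_val.div ?_ ?_
  · exact Complex.continuous_ofReal.comp (continuous_norm.comp continuous_subtype_val)
  · intro z
    exact_mod_cast norm_ne_zero_iff.2 z.2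

theorem exists_continuous_arg_of_homotopy {X : Type*} [TopologicalSpace X]
    (H : C(unitInterval × X, ℂ)) (hH : ∀ z, H z ≠ 0) (θ₀ : C(X, ℝ))
    (h0 : ∀ x, H (0, x) = ‖H (0, x)‖ * Complex.exp (θ₀ x * Complex.I)) :
    ∃ θ : C(unitInterval × X, ℝ), (∀ x, θ (0, x) = θ₀ x) ∧
      ∀ z, H z = ‖H z‖ * Complex.exp (θ z * Complex.I) := by
  let K : C(unitInterval × X, Circle) :=
    ⟨fun z => unitCircleProj ⟨H z, hH z⟩,
      continuous_unitCircleProj.comp (H.continuous.subtype_mk _)⟩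
  have hK0 : ∀ x, K (0, x) = Circle.exp (θ₀ x) := by
    intro x
    apply Circle.ext
    have hn : (‖H (0, x)‖ : ℂ) ≠ 0 := by exact_mod_cast norm_ne_zero_iff.2 (hH _)
    change H (0, x) / ‖H (0, x)‖ = _
    rw [div_eq_iff hn, Circle.coe_exp, mul_comm]
    exact h0 x
  refine ⟨Circle.isCoveringMap_exp.liftHomotopy K θ₀ hK0, fun x =>
    Circle.isCoveringMap_exp.liftHomotopy_zero K θ₀ hK0 x, fun z => ?_⟩
  have h := congr_fun (Circle.isCoveringMap_exp.liftHomotopy_lifts K θ₀ hK0) z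
  have h' := congrArg (fun c : Circle => (c : ℂ)) h
  have hn : (‖H z‖ : ℂ) ≠ 0 := by exact_mod_cast norm_ne_zero_iff.2 (hH _)
  change _ = H z / ‖H z‖ at h'
  rw [eq_div_iff hn] at h'
  refine h'.symm.trans ?_
  rw [mul_comm]
  rfl

theorem exists_continuous_arg_square (G : C(unitInterval × unitInterval, ℂ))
    (hG : ∀ z, G z ≠ 0) :
    ∃ θ : C(unitInterval × unitInterval, ℝ),
      ∀ z, G z = ‖G z‖ * Complex.exp (θ z * Complex.I) := by
  let G₀ : C(unitInterval × Unit, ℂ) := ⟨fun z => G (0, z.1), by fun_prop⟩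
  obtain ⟨θ₀, -, h₀⟩ := exists_continuous_arg_of_homotopy G₀ (fun z => hG _)
    (ContinuousMap.const _ (Complex.arg (G (0, 0))))
    (fun x => (Complex.norm_mul_exp_arg_mul_I (G (0, 0))).symm)
  obtain ⟨θ, -, h⟩ := exists_continuous_arg_of_homotopy G hG
    ⟨fun x => θ₀ (x, ()), by fun_prop⟩ (fun x => h₀ (x, ()))
  exact ⟨θ, h⟩

theorem exists_int_abs_sub_lt_of_cos_pos {X : Type*} [TopologicalSpace X] [PreconnectedSpace X]
    [Nonempty X] {θ : X → ℝ} (hθ : Continuous θ) (h : ∀ x, 0 < Real.cos (θ x)) :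
    ∃ k : ℤ, ∀ x, |θ x - 2 * π * k| < π / 2 := by
  obtain ⟨x₀⟩ := ‹Nonempty X›
  have key : ∀ x (k : ℤ), |θ x - 2 * π * k| ≠ π / 2 := by
    intro x k hk
    have h1 := h x
    rw [← Real.cos_sub_int_mul_two_pi (θ x) k, ← Real.cos_abs,
      show θ x - k * (2 * π) = θ x - 2 * π * k by ring, hk, Real.cos_pi_div_two] at h1
    exact lt_irrefl _ h1
  have base : |θ x₀ - 2 * π * (round (θ x₀ / (2 * π)) : ℤ)| < π / 2 := by
    have h1 := abs_sub_round (θ x₀ / (2 * π))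
    set k := round (θ x₀ / (2 * π))
    have hpi := Real.pi_pos
    have h2 : |θ x₀ - 2 * π * k| ≤ π := by
      have : θ x₀ - 2 * π * k = (2 * π) * (θ x₀ / (2 * π) - k) := by field_simp
      rw [this, abs_mul, abs_of_pos (by positivity)]
      nlinarith
    by_contra! h3
    have h4 := Real.cos_nonpos_of_pi_div_two_le_of_le h3 (by linarith)
    have h5 := h x₀
    rw [← Real.cos_sub_int_mul_two_pi (θ x₀) k, ← Real.cos_abs,
      show θ x₀ - k * (2 * π) = θ x₀ - 2 * π * k by ring] at h5
    linarith
  refine ⟨round (θ x₀ / (2 * π)), fun x => ?_⟩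
  by_contra! h1
  have hc : Continuous fun x => |θ x - 2 * π * (round (θ x₀ / (2 * π)) : ℤ)| := by fun_prop
  obtain ⟨y, hy⟩ := mem_range_of_exists_le_of_exists_ge hc ⟨x₀, base.le⟩ ⟨x, h1⟩
  exact key _ _ hy

/-- A continuous map on the unit square whose values on the four sides lie in the four open
half planes bounded by the axes, in cyclic order, has a zero. -/
theorem exists_zero_of_square_boundary (G : C(unitInterval × unitInterval, ℂ))
    (hbot : ∀ x, (G (x, 0)).re < 0) (htop : ∀ x, 0 < (G (x, 1)).re)
    (hleft : ∀ y, (G (0, y)).im < 0) (hright : ∀ y, 0 < (G (1, y)).im) :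
    ∃ z, G z = 0 := by
  by_contra! hG
  obtain ⟨θ, hθ⟩ := exists_continuous_arg_square G hG
  have hre : ∀ z, (G z).re = ‖G z‖ * Real.cos (θ z) := fun z => by
    conv_lhs => rw [hθ z]
    rw [Complex.re_ofReal_mul, Complex.exp_ofReal_mul_I_re]
  have him : ∀ z, (G z).im = ‖G z‖ * Real.sin (θ z) := fun z => by
    conv_lhs => rw [hθ z]
    rw [Complex.im_ofReal_mul, Complex.exp_ofReal_mul_I_im]
  have hn : ∀ z, 0 < ‖G z‖ := fun z => norm_pos_iff.2 (hG z)
  obtain ⟨k₁, h₁⟩ := exists_int_abs_sub_lt_of_cos_pos (X := unitInterval)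
    (θ := fun x => θ (x, 0) - π) (by fun_prop) (fun x => by
      rw [Real.cos_sub_pi]
      have := hbot x
      rw [hre] at this
      nlinarith [hn (x, 0)])
  obtain ⟨k₂, h₂⟩ := exists_int_abs_sub_lt_of_cos_pos (X := unitInterval)
    (θ := fun x => θ (1, x) - π / 2) (by fun_prop) (fun x => by
      rw [Real.cos_sub_pi_div_two]
      have := hright x
      rw [him] at this
      exact pos_of_mul_pos_right this (hn _).le)
  obtain ⟨k₃, h₃⟩ := exists_int_abs_sub_lt_of_cos_pos (X := unitInterval)
    (θ := fun x => θ (x, 1)) (by fun_prop) (fun x => by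
      have := htop x
      rw [hre] at this
      exact pos_of_mul_pos_right this (hn _).le)
  obtain ⟨k₄, h₄⟩ := exists_int_abs_sub_lt_of_cos_pos (X := unitInterval)
    (θ := fun x => θ (0, x) + π / 2) (by fun_prop) (fun x => by
      rw [Real.cos_add_pi_div_two]
      have := hleft x
      rw [him] at this
      nlinarith [hn (0, x)])
  have a1 := abs_lt.1 (h₁ 0)
  have a2 := abs_lt.1 (h₁ 1)
  have b1 := abs_lt.1 (h₂ 0)
  have b2 := abs_lt.1 (h₂ 1)
  have c1 := abs_lt.1 (h₃ 0)
  have c2 := abs_lt.1 (h₃ 1)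
  have d1 := abs_lt.1 (h₄ 0)
  have d2 := abs_lt.1 (h₄ 1)
  have hpi := Real.pi_pos
  have lt_of : ∀ a b : ℤ, π * a < π * b → a < b := fun a b h => by
    have := lt_of_mul_lt_mul_left h hpi.le
    exact_mod_cast this
  have e1 := lt_of (4 * k₁ - 4 * k₂) 1 (by push_cast; linarith)
  have e2 := lt_of (-3) (4 * k₁ - 4 * k₂) (by push_cast; linarith)
  have e3 := lt_of (4 * k₂ - 4 * k₃) 1 (by push_cast; linarith)
  have e4 := lt_of (-3) (4 * k₂ - 4 * k₃) (by push_cast; linarith)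
  have e5 := lt_of (4 * k₃ - 4 * k₄) 1 (by push_cast; linarith)
  have e6 := lt_of (-3) (4 * k₃ - 4 * k₄) (by push_cast; linarith)
  have e7 := lt_of 1 (4 * k₄ - 4 * k₁) (by push_cast; linarith)
  omega

/-- A continuous family `f(·, y)` of `1`-periodic functions that is `< r` on the line `y = c` and
`> r` on the line `y = d` admits no continuous integer valued function on the level set `f = r`
which increases by one under the unit translation. -/
theorem no_equivariant_index {f : ℝ × ℝ → ℝ} (hf : Continuous f) {r c d : ℝ}
    (hper : ∀ x y, f (x + 1, y) = f (x, y))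
    (hcd : c < d) (hbot : ∀ x, f (x, c) < r) (htop : ∀ x, r < f (x, d)) {N : ℝ × ℝ → ℤ}
    (hN : ContinuousOn N {z | f z = r ∧ z.2 ∈ Icc c d})
    (hN1 : ∀ x y, f (x, y) = r → y ∈ Icc c d → N (x + 1, y) = N (x, y) + 1) : False := by
  set S : Set (ℝ × ℝ) := {z | f z = r ∧ z.2 ∈ Icc c d} with hS
  have hSc : IsClosed S :=
    (isClosed_eq hf continuous_const).inter (isClosed_Icc.preimage continuous_snd)
  have hperN : ∀ (n : ℕ) x y, f (x + n, y) = f (x, y) := by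
    intro n
    induction n with
    | zero => simp
    | succ n ih => intro x y; rw [Nat.cast_succ, ← add_assoc, hper, ih]
  have hNN : ∀ (n : ℕ) x y, f (x, y) = r → y ∈ Icc c d → N (x + n, y) = N (x, y) + n := by
    intro n
    induction n with
    | zero => simp
    | succ n ih =>
      intro x y h hy
      rw [Nat.cast_succ, ← add_assoc, hN1 _ _ (by rw [hperN, h]) hy, ih x y h hy]
      push_cast; ring
  have hcpt : IsCompact (N '' (S ∩ (({0} : Set ℝ) ×ˢ Icc c d))) :=
    ((isCompact_singleton.prod isCompact_Icc).inter_left hSc).image_of_continuousOn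
      (hN.mono inter_subset_left)
  obtain ⟨B₁, hB₁⟩ := hcpt.bddAbove
  obtain ⟨B₂, hB₂⟩ := hcpt.bddBelow
  obtain ⟨X, hX⟩ : ∃ X : ℕ, B₁ < X ∧ -B₂ < X ∧ 0 < X :=
    ⟨B₁.toNat + (-B₂).toNat + 1, by omega, by omega, by omega⟩
  have hleftN : ∀ y, ((-X : ℝ), y) ∈ S → N (-X, y) ≤ 0 := by
    rintro y ⟨h, hy⟩
    have h0 : f (0, y) = r := by rw [← h, ← hperN X (-X) y]; simp
    have h1 := hNN X (-X) y h hy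
    have h2 := hB₁ ⟨(0, y), ⟨⟨h0, hy⟩, by simpa using hy⟩, rfl⟩
    simp only [neg_add_cancel] at h1
    omega
  have hrightN : ∀ y, ((X : ℝ), y) ∈ S → 1 ≤ N (X, y) := by
    rintro y ⟨h, hy⟩
    have h0 : f (0, y) = r := by rw [← h, ← hperN X 0 y]; simp
    have h1 := hNN X 0 y h0 hy
    have h2 := hB₂ ⟨(0, y), ⟨⟨h0, hy⟩, by simpa using hy⟩, rfl⟩
    simp only [zero_add] at h1
    omega
  set T₀ : Set (ℝ × ℝ) := (S ∩ N ⁻¹' Iic 0) ∪ {z | z.1 = -X} with hT₀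
  set T₁ : Set (ℝ × ℝ) := (S ∩ N ⁻¹' Ici 1) ∪ {z | z.1 = X} with hT₁
  have hT₀c : IsClosed T₀ := (hN.preimage_isClosed_of_isClosed hSc isClosed_Iic).union
    (isClosed_eq continuous_fst continuous_const)
  have hT₁c : IsClosed T₁ := (hN.preimage_isClosed_of_isClosed hSc isClosed_Ici).union
    (isClosed_eq continuous_fst continuous_const)
  have hT₀n : T₀.Nonempty := ⟨(-X, 0), Or.inr rfl⟩
  have hT₁n : T₁.Nonempty := ⟨(X, 0), Or.inr rfl⟩
  have hXpos : (0 : ℝ) < X := by exact_mod_cast hX.2.2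
  have hdisj : ∀ z, z ∈ T₀ → z ∉ T₁ := by
    rintro ⟨x, y⟩ (⟨h, h0⟩ | h) (⟨h', h1⟩ | h')
    · simp only [mem_preimage, mem_Iic, mem_Ici] at h0 h1
      omega
    · simp only [mem_ofPred_eq] at h'
      subst h'
      have := hrightN y h
      simp only [mem_preimage, mem_Iic] at h0
      omega
    · simp only [mem_ofPred_eq] at h
      subst h
      have := hleftN y h'
      simp only [mem_preimage, mem_Ici] at h1
      omega
    · simp only [mem_ofPred_eq] at h h'
      linarith
  set u : ℝ × ℝ → ℝ := fun z => Metric.infDist z T₀ - Metric.infDist z T₁ with hu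
  have huc : Continuous u := (Metric.continuous_infDist_pt _).sub (Metric.continuous_infDist_pt _)
  have hu0 : ∀ z ∈ T₀, u z < 0 := fun z hz => by
    have h1 := (hT₁c.notMem_iff_infDist_pos hT₁n).1 (hdisj z hz)
    simp only [hu, Metric.infDist_zero_of_mem hz]
    linarith
  have hu1 : ∀ z ∈ T₁, 0 < u z := fun z hz => by
    have h1 := (hT₀c.notMem_iff_infDist_pos hT₀n).1 (fun h => hdisj z h hz)
    simp only [hu, Metric.infDist_zero_of_mem hz]
    linarith
  let e : unitInterval × unitInterval → ℝ × ℝ :=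
    fun z => (-X + 2 * X * (z.1 : ℝ), c + (d - c) * (z.2 : ℝ))
  have he : Continuous e := by fun_prop
  let G : C(unitInterval × unitInterval, ℂ) := ⟨fun z => ⟨f (e z) - r, u (e z)⟩, by
    have h1 : Continuous fun z => f (e z) - r := (hf.comp he).sub continuous_const
    have h2 : Continuous fun z => u (e z) := huc.comp he
    have h3 : (fun z => (⟨f (e z) - r, u (e z)⟩ : ℂ)) =
        fun z => ((f (e z) - r : ℝ) : ℂ) + ((u (e z) : ℝ) : ℂ) * Complex.I := by
      funext z
      exact Complex.mk_eq_add_mul_I _ _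
    rw [h3]
    fun_prop⟩
  obtain ⟨z, hz⟩ := exists_zero_of_square_boundary G
    (fun x => by simpa [G, e] using hbot _)
    (fun x => by simpa [G, e] using htop _)
    (fun y => hu0 _ (Or.inr (by simp [e])))
    (fun y => hu1 _ (Or.inr (by simp [e]; ring)))
  have hz1 : f (e z) - r = 0 := congrArg Complex.re hz
  have hz2 : u (e z) = 0 := congrArg Complex.im hz
  have hzS : e z ∈ S := by
    refine ⟨by linarith, ?_, ?_⟩
    · have := z.2.2.1
      simp only [e]
      nlinarith
    · have := z.2.2.2
      simp only [e]
      nlinarith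
  rcases le_or_gt (N (e z)) 0 with h | h
  · exact (hu0 _ (Or.inl ⟨hzS, h⟩)).ne hz2
  · exact (hu1 _ (Or.inl ⟨hzS, h⟩)).ne' hz2

/-- `θ` is an argument of `z`. -/
def IsArg (z : ℂ) (θ : ℝ) : Prop := z = ‖z‖ * Complex.exp (θ * Complex.I)

theorem isArg_arg (z : ℂ) : IsArg z (Complex.arg z) := (Complex.norm_mul_exp_arg_mul_I z).symm

theorem IsArg.mul {z w : ℂ} {θ φ : ℝ} (hz : IsArg z θ) (hw : IsArg w φ) :
    IsArg (z * w) (θ + φ) := by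
  unfold IsArg at *
  rw [norm_mul]
  conv_lhs => rw [hz, hw]
  push_cast
  rw [add_mul, Complex.exp_add]
  ring

theorem IsArg.inv {z : ℂ} {θ : ℝ} (hz : IsArg z θ) : IsArg z⁻¹ (-θ) := by
  unfold IsArg at *
  conv_lhs => rw [hz]
  rw [mul_inv, ← Complex.exp_neg, norm_inv]
  push_cast
  ring_nf

theorem exists_continuousOn_arg_div {u v : ℂ} (Γ : Path u v) :
    ∃ θ : ℂ → ℝ, ContinuousOn θ (range Γ)ᶜ ∧
      ∀ w ∈ (range Γ)ᶜ, IsArg ((w - v) / (w - u)) (θ w) := by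
  classical
  let Ω : Set ℂ := (range Γ)ᶜ
  have hne : ∀ (w : Ω) t, (w : ℂ) - Γ t ≠ 0 := fun w t h =>
    w.2 ⟨t, (sub_eq_zero.1 h).symm⟩
  have hne0 : ∀ (w : Ω), (w : ℂ) - u ≠ 0 := fun w => by simpa using hne w 0
  let H : C(unitInterval × Ω, ℂ) := ⟨fun z => ((z.2 : ℂ) - Γ z.1) / ((z.2 : ℂ) - u), by
    refine Continuous.div ?_ ?_ (fun z => hne0 z.2)
    · exact (continuous_subtype_val.comp continuous_snd).sub (Γ.continuous.comp continuous_fst)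
    · exact (continuous_subtype_val.comp continuous_snd).sub continuous_const⟩
  obtain ⟨θ, -, hθ⟩ := exists_continuous_arg_of_homotopy H
    (fun z => div_ne_zero (hne _ _) (hne0 _)) (ContinuousMap.const _ 0) (fun w => by
      simp [H, div_self (hne0 w)])
  refine ⟨fun w => if h : w ∈ Ω then θ (1, ⟨w, h⟩) else 0, ?_, fun w hw => ?_⟩
  · rw [continuousOn_iff_continuous_domRestrict]
    have : Ω.domRestrict (fun w => if h : w ∈ Ω then θ (1, ⟨w, h⟩) else 0) =
        fun w => θ (1, w) := by
      funext w
      exact dif_pos w.2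
    change Continuous (Ω.domRestrict fun w => if h : w ∈ Ω then θ (1, ⟨w, h⟩) else 0)
    rw [this]
    fun_prop
  · have h := hθ (1, ⟨w, hw⟩)
    have hw' : w ∈ Ω := hw
    simp only [hw', dite_true]
    simpa [H, IsArg] using h

/-- The complement of a path crossing an annulus carries a continuous argument function. -/
theorem exists_continuousOn_arg_annulus {u v : ℂ} (Γ : Path u v) :
    ∃ θ : ℂ → ℝ, ContinuousOn θ {w | ‖u‖ < ‖w‖ ∧ ‖w‖ < ‖v‖ ∧ w ∉ range Γ} ∧
      ∀ w, ‖u‖ < ‖w‖ → ‖w‖ < ‖v‖ → w ∉ range Γ → IsArg w (θ w) := by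
  obtain ⟨θ, hc, hθ⟩ := exists_continuousOn_arg_div Γ
  have hslit : ∀ z : ℂ, ‖z‖ < 1 → 1 - z ∈ Complex.slitPlane := fun z hz => by
    left
    have := (Complex.abs_re_le_norm z).trans_lt hz
    have := (abs_lt.1 this).2
    simp only [Complex.sub_re, Complex.one_re]
    linarith
  have hlt : ∀ {a b : ℂ}, ‖a‖ < ‖b‖ → ‖a / b‖ < 1 := fun {a b} h => by
    rw [norm_div, div_lt_one ((norm_nonneg _).trans_lt h)]
    exact h
  refine ⟨fun w => Complex.arg (-v) + Complex.arg (1 - w / v) + -θ w +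
    -Complex.arg (1 - u / w), ?_, fun w h1 h2 h3 => ?_⟩
  · refine ContinuousOn.add (ContinuousOn.add (ContinuousOn.add continuousOn_const ?_) ?_) ?_
    · intro w hw
      refine ContinuousAt.continuousWithinAt ?_
      exact (Complex.continuousAt_arg (hslit _ (hlt hw.2.1))).comp (f := fun w : ℂ => 1 - w / v)
        (by fun_prop)
    · exact (hc.mono fun w hw => hw.2.2).neg
    · refine ContinuousOn.neg ?_
      intro w hw
      have hw0 : w ≠ 0 := norm_pos_iff.1 ((norm_nonneg _).trans_lt hw.1)
      refine ContinuousAt.continuousWithinAt ?_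
      exact (Complex.continuousAt_arg (hslit _ (hlt hw.1))).comp (f := fun w : ℂ => 1 - u / w)
        (by fun_prop (disch := assumption))
  · have hw0 : w ≠ 0 := norm_pos_iff.1 ((norm_nonneg _).trans_lt h1)
    have hv0 : v ≠ 0 := norm_pos_iff.1 ((norm_nonneg _).trans_lt h2)
    have hwu : w - u ≠ 0 := sub_ne_zero.2 fun h => by simp [h] at h1
    have hwv : w - v ≠ 0 := sub_ne_zero.2 fun h => by simp [h] at h2
    have := (((isArg_arg (-v)).mul (isArg_arg (1 - w / v))).mul (hθ w h3).inv).mul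
      (isArg_arg (1 - u / w)).inv
    have hE : -v * (1 - w / v) * ((w - v) / (w - u))⁻¹ * (1 - u / w)⁻¹ = w := by
      have e1 : 1 - w / v = -(w - v) / v := by field_simp; ring
      have e2 : 1 - u / w = (w - u) / w := by field_simp
      rw [e1, e2]
      field_simp
    rwa [hE] at this

section Velocity

theorem hasDerivAt_vel {γ : ℝ → V2} {t : ℝ} (h : DifferentiableAt ℝ γ t) :
    HasDerivAt γ (vel γ t) t :=
  hasDerivAt_pi.2 fun i => (differentiableAt_pi.1 h i).hasDerivAt

theorem HasDerivAt.vel_eq {γ : ℝ → V2} {v : V2} {t : ℝ} (h : HasDerivAt γ v t) : vel γ t = v :=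
  (hasDerivAt_vel h.differentiableAt).unique h

theorem continuous_vel {γ : ℝ → V2} (h : ContDiff ℝ 1 γ) : Continuous (vel γ) := by
  have : vel γ = deriv γ := funext fun t =>
    (hasDerivAt_vel (h.differentiable one_ne_zero t)).deriv.symm
  rw [this]
  exact h.continuous_deriv_one

end Velocity

namespace RMetric

variable (M : RMetric)

/-- The Riemannian norm of the tangent vector `v` at `p`. -/
noncomputable def speed (p v : V2) : ℝ := Real.sqrt (M.met p v v)

theorem met_smul (p v : V2) (c : ℝ) : M.met p (c • v) (c • v) = c ^ 2 * M.met p v v := by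
  simp only [met, Fin.sum_univ_two, Pi.smul_apply, smul_eq_mul]
  ring

theorem met_pos (p : V2) {v : V2} (hv : v ≠ 0) : 0 < M.met p v v := by
  have := (M.posDef p).dotProduct_mulVec_pos hv
  simp only [dotProduct, Matrix.mulVec, Fin.sum_univ_two, Pi.star_apply, star_trivial] at this
  simp only [met, Fin.sum_univ_two]
  linarith

theorem speed_nonneg (p v : V2) : 0 ≤ M.speed p v := Real.sqrt_nonneg _

theorem speed_pos (p : V2) {v : V2} (hv : v ≠ 0) : 0 < M.speed p v :=
  Real.sqrt_pos.2 (M.met_pos p hv)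

theorem speed_smul (p v : V2) (c : ℝ) : M.speed p (c • v) = |c| * M.speed p v := by
  rw [speed, met_smul, Real.sqrt_mul (sq_nonneg c), Real.sqrt_sq_eq_abs, speed]

theorem continuous_speed : Continuous fun z : V2 × V2 => M.speed z.1 z.2 := by
  have h : ∀ i j, Continuous fun p => M.g p i j := fun i j => (M.smooth i j).continuous
  unfold speed met
  refine Real.continuous_sqrt.comp ?_
  refine continuous_finsetSum _ fun i _ => continuous_finsetSum _ fun j _ => ?_
  have := (h i j).comp (continuous_fst : Continuous (Prod.fst : V2 × V2 → V2))
  refine (this.mul ?_).mul ?_ <;> fun_prop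

theorem curveLen_eq (γ : ℝ → V2) (a b : ℝ) :
    M.curveLen γ a b = ∫ t in a..b, M.speed (γ t) (vel γ t) := rfl

theorem continuous_speed_vel {γ : ℝ → V2} (h : ContDiff ℝ 1 γ) :
    Continuous fun t => M.speed (γ t) (vel γ t) :=
  M.continuous_speed.comp (h.continuous.prodMk (continuous_vel h))

theorem curveLen_nonneg (γ : ℝ → V2) {a b : ℝ} (hab : a ≤ b) : 0 ≤ M.curveLen γ a b :=
  intervalIntegral.integral_nonneg hab fun _ _ => M.speed_nonneg _ _

theorem curveLen_add {γ : ℝ → V2} (h : ContDiff ℝ 1 γ) (a b c : ℝ) :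
    M.curveLen γ a b + M.curveLen γ b c = M.curveLen γ a c :=
  intervalIntegral.integral_add_adjacent_intervals
    ((M.continuous_speed_vel h).intervalIntegrable _ _)
    ((M.continuous_speed_vel h).intervalIntegrable _ _)

theorem curveLen_congr {γ η : ℝ → V2} {a b : ℝ} (hab : a ≤ b) (h : EqOn γ η (Ioo a b)) :
    M.curveLen γ a b = M.curveLen η a b := by
  refine intervalIntegral.integral_congr_Ioo_of_le hab fun t ht => ?_
  have hv : vel γ t = vel η t := funext fun k => Filter.EventuallyEq.deriv_eq <|
    (Filter.eventually_of_mem (Ioo_mem_nhds ht.1 ht.2) fun s hs => congrFun (h hs) k)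
  simp only [hv, h ht]

theorem speed_comp {γ : ℝ → V2} (h : ContDiff ℝ 1 γ) {φ : ℝ → ℝ} {c t : ℝ}
    (hφ : HasDerivAt φ c t) :
    M.speed (γ (φ t)) (vel (fun s => γ (φ s)) t) = M.speed (γ (φ t)) (vel γ (φ t)) * |c| := by
  have : HasDerivAt (fun s => γ (φ s)) (c • vel γ (φ t)) t :=
    (hasDerivAt_vel (h.differentiable one_ne_zero (φ t))).scomp t hφ
  rw [this.vel_eq, speed_smul, mul_comm]

theorem curveLen_comp {γ : ℝ → V2} (h : ContDiff ℝ 1 γ) {φ : ℝ → ℝ} (hφ : ContDiff ℝ 1 φ)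
    (hm : Monotone φ) (a b : ℝ) :
    M.curveLen (fun s => γ (φ s)) a b = M.curveLen γ (φ a) (φ b) := by
  rw [curveLen_eq, curveLen_eq,
    ← intervalIntegral.integral_comp_mul_deriv (f' := deriv φ)
      (fun x _ => (hφ.differentiable one_ne_zero x).hasDerivAt)
      hφ.continuous_deriv_one.continuousOn (M.continuous_speed_vel h)]
  refine intervalIntegral.integral_congr fun t _ => ?_
  have := M.speed_comp h (hφ.differentiable one_ne_zero t).hasDerivAt
  rw [abs_of_nonneg hm.deriv_nonneg] at this
  exact this

theorem curveLen_reverse {γ : ℝ → V2} (h : ContDiff ℝ 1 γ) :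
    M.curveLen (fun s => γ (1 - s)) 0 1 = M.curveLen γ 0 1 := by
  rw [curveLen_eq, curveLen_eq]
  have := intervalIntegral.integral_comp_sub_left (a := 0) (b := 1)
    (fun t => M.speed (γ t) (vel γ t)) 1
  simp only [sub_self, sub_zero] at this
  rw [← this]
  refine intervalIntegral.integral_congr fun t _ => ?_
  have h1 : HasDerivAt (fun s : ℝ => 1 - s) (-1) t := by
    simpa using (hasDerivAt_id t).const_sub 1
  simpa using M.speed_comp h h1

theorem dist_le_curveLen_unit {γ : ℝ → V2} (h : ContDiff ℝ 1 γ) :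
    M.dist (γ 0) (γ 1) ≤ M.curveLen γ 0 1 := by
  refine csInf_le ⟨0, ?_⟩ ⟨γ, h, rfl, rfl, rfl⟩
  rintro _ ⟨η, -, -, -, rfl⟩
  exact M.curveLen_nonneg η zero_le_one

theorem contDiff_segment (p q : V2) : ContDiff ℝ 1 fun t : ℝ => p + t • (q - p) := by
  fun_prop

theorem dist_set_nonempty (p q : V2) :
    {L | ∃ γ : ℝ → V2, ContDiff ℝ 1 γ ∧ γ 0 = p ∧ γ 1 = q ∧ L = M.curveLen γ 0 1}.Nonempty :=
  ⟨_, _, contDiff_segment p q, by simp, by simp, rfl⟩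

theorem le_dist {p q : V2} {c : ℝ}
    (h : ∀ γ : ℝ → V2, ContDiff ℝ 1 γ → γ 0 = p → γ 1 = q → c ≤ M.curveLen γ 0 1) :
    c ≤ M.dist p q := by
  refine le_csInf (M.dist_set_nonempty p q) ?_
  rintro _ ⟨γ, h1, h2, h3, rfl⟩
  exact h γ h1 h2 h3

theorem exists_curveLen_lt {p q : V2} {c : ℝ} (h : M.dist p q < c) :
    ∃ γ : ℝ → V2, ContDiff ℝ 1 γ ∧ γ 0 = p ∧ γ 1 = q ∧ M.curveLen γ 0 1 < c := by
  obtain ⟨_, ⟨γ, h1, h2, h3, rfl⟩, h4⟩ := exists_lt_of_csInf_lt (M.dist_set_nonempty p q) h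
  exact ⟨γ, h1, h2, h3, h4⟩

theorem dist_nonneg (p q : V2) : 0 ≤ M.dist p q :=
  M.le_dist fun γ _ _ _ => M.curveLen_nonneg γ zero_le_one

theorem dist_comm_le (p q : V2) : M.dist q p ≤ M.dist p q := by
  refine M.le_dist fun γ h h0 h1 => ?_
  rw [← M.curveLen_reverse h]
  have := M.dist_le_curveLen_unit (γ := fun s => γ (1 - s)) (by fun_prop)
  simpa [h0, h1] using this

theorem dist_comm (p q : V2) : M.dist p q = M.dist q p :=
  le_antisymm (M.dist_comm_le q p) (M.dist_comm_le p q)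

theorem dist_le_curveLen {γ : ℝ → V2} (h : ContDiff ℝ 1 γ) {a b : ℝ} (hab : a ≤ b) :
    M.dist (γ a) (γ b) ≤ M.curveLen γ a b := by
  have hm : Monotone fun t : ℝ => a + t * (b - a) := fun s t hst => by
    have := mul_le_mul_of_nonneg_right hst (sub_nonneg.2 hab)
    simp only
    linarith
  have h1 := M.curveLen_comp h (φ := fun t => a + t * (b - a)) (by fun_prop) hm 0 1
  have h2 := M.dist_le_curveLen_unit (γ := fun t => γ (a + t * (b - a))) (by fun_prop)
  rw [h1] at h2
  simpa using h2

theorem dist_self (p : V2) : M.dist p p = 0 := by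
  refine le_antisymm ?_ (M.dist_nonneg p p)
  have := M.dist_le_curveLen (γ := fun _ => p) contDiff_const (le_refl (0 : ℝ))
  simpa [curveLen_eq] using this

theorem dist_triangle (p q s : V2) : M.dist p s ≤ M.dist p q + M.dist q s := by
  refine le_of_forall_pos_le_add fun ε hε => ?_
  obtain ⟨γ, h, h0, h1, hl⟩ := M.exists_curveLen_lt (lt_add_of_pos_right (M.dist p q) (half_pos hε))
  obtain ⟨η, k, k0, k1, kl⟩ := M.exists_curveLen_lt (lt_add_of_pos_right (M.dist q s) (half_pos hε))
  let φ := Real.smoothTransition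
  have hφ : ContDiff ℝ 1 φ := Real.smoothTransition.contDiff
  have m1 : Monotone fun t : ℝ => φ (2 * t) := fun a b hab =>
    Real.smoothTransition.monotone (by linarith)
  have m2 : Monotone fun t : ℝ => φ (2 * t - 1) := fun a b hab =>
    Real.smoothTransition.monotone (by linarith)
  let ω : ℝ → V2 := fun t => γ (φ (2 * t)) + (η (φ (2 * t - 1)) - q)
  have hω : ContDiff ℝ 1 ω := by fun_prop
  have e1 : M.curveLen ω 0 (1 / 2) = M.curveLen γ 0 1 := by
    rw [M.curveLen_congr (η := fun t => γ (φ (2 * t))) (by norm_num),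
      M.curveLen_comp h (φ := fun t => φ (2 * t)) (by fun_prop) m1]
    · simp [φ]
    · intro t ht
      have : φ (2 * t - 1) = 0 := Real.smoothTransition.zero_of_nonpos (by linarith [ht.2])
      simp [ω, this, k0]
  have e2 : M.curveLen ω (1 / 2) 1 = M.curveLen η 0 1 := by
    rw [M.curveLen_congr (η := fun t => η (φ (2 * t - 1))) (by norm_num),
      M.curveLen_comp k (φ := fun t => φ (2 * t - 1)) (by fun_prop) m2]
    · norm_num [φ]
    · intro t ht
      have : φ (2 * t) = 1 := Real.smoothTransition.one_of_one_le (by linarith [ht.1])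
      simp [ω, this, h1]
  have := M.dist_le_curveLen_unit hω
  rw [← M.curveLen_add hω 0 (1 / 2) 1, e1, e2] at this
  have w0 : ω 0 = p := by
    have : φ (-1) = 0 := Real.smoothTransition.zero_of_nonpos (by norm_num)
    simp [ω, this, k0, h0, φ]
  have w1 : ω 1 = s := by
    have e : φ (2 * 1 - 1) = 1 := Real.smoothTransition.one_of_one_le (by norm_num)
    have e' : φ (2 * 1) = 1 := Real.smoothTransition.one_of_one_le (by norm_num)
    simp only [ω, e, e', h1, k1, add_sub_cancel]
  rw [w0, w1] at this
  linarith

end RMetric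

@[simp] theorem shift_apply_zero (n : ℤ) (p : V2) : shift n p 0 = p 0 + n := by simp [shift]

@[simp] theorem shift_apply_one (n : ℤ) (p : V2) : shift n p 1 = p 1 := by simp [shift]

theorem v2_ext {p q : V2} (h0 : p 0 = q 0) (h1 : p 1 = q 1) : p = q := by
  ext i
  fin_cases i
  · exact h0
  · exact h1

@[simp] theorem shift_zero (p : V2) : shift 0 p = p := by simp [shift]

theorem shift_shift (m n : ℤ) (p : V2) : shift m (shift n p) = shift (m + n) p :=
  v2_ext (by simp; ring) (by simp)

@[simp] theorem shift_neg_shift (n : ℤ) (p : V2) : shift (-n) (shift n p) = p := by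
  simp [shift_shift]

@[simp] theorem shift_shift_neg (n : ℤ) (p : V2) : shift n (shift (-n) p) = p := by
  simp [shift_shift]

theorem norm_single_zero : ‖(Pi.single 0 1 : V2)‖ = 1 := by
  rw [Pi.norm_single, norm_one]

theorem norm_sub_shift (n : ℤ) (p : V2) : ‖p - shift n p‖ = |(n : ℝ)| := by
  have h : ‖(Pi.single 0 1 : V2)‖ = 1 := norm_single_zero
  rw [shift, sub_add_cancel_left, norm_neg, norm_smul, h, mul_one, Real.norm_eq_abs]

namespace CylMetric

variable (C : CylMetric)

theorem g_shift (n : ℤ) (p : V2) : C.M.g (shift n p) = C.M.g p := by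
  induction n using Int.induction_on generalizing p with
  | zero => simp
  | succ n ih => rw [← shift_shift, ih, C.invariant]
  | pred n ih =>
    rw [← C.invariant (shift _ p), shift_shift]
    convert ih p using 3
    ring

theorem speed_shift (n : ℤ) (p v : V2) : C.M.speed (shift n p) v = C.M.speed p v := by
  simp only [RMetric.speed, RMetric.met, g_shift]

theorem dist_shift_shift_le (n : ℤ) (p q : V2) :
    C.M.dist (shift n p) (shift n q) ≤ C.M.dist p q := by
  refine C.M.le_dist fun γ h h0 h1 => ?_
  have h2 := C.M.dist_le_curveLen_unit (γ := fun t => shift n (γ t)) (by unfold shift; fun_prop)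
  rw [h0, h1] at h2
  refine h2.trans (le_of_eq ?_)
  refine intervalIntegral.integral_congr fun t _ => ?_
  have hv : vel (fun t => shift n (γ t)) t = vel γ t :=
    ((hasDerivAt_vel (h.differentiable one_ne_zero t)).add_const _).vel_eq
  change C.M.speed _ (vel (fun t => shift n (γ t)) t) = C.M.speed _ _
  rw [hv, C.speed_shift]

theorem dist_shift_shift (n : ℤ) (p q : V2) :
    C.M.dist (shift n p) (shift n q) = C.M.dist p q :=
  le_antisymm (C.dist_shift_shift_le n p q) <| by
    simpa using C.dist_shift_shift_le (-n) (shift n p) (shift n q)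

/-- A period rectangle of height `Y`. -/
def periodBox (Y : ℝ) : Set V2 := Icc ![0, -Y] ![1, Y]

theorem mem_periodBox {Y : ℝ} {p : V2} :
    p ∈ periodBox Y ↔ (0 ≤ p 0 ∧ p 0 ≤ 1) ∧ |p 1| ≤ Y := by
  simp only [periodBox, mem_Icc, Pi.le_def, Fin.forall_fin_two, abs_le]
  simp
  tauto

theorem isCompact_periodBox (Y : ℝ) : IsCompact (periodBox Y) := isCompact_Icc

theorem shift_floor_mem_periodBox {Y : ℝ} {p : V2} (hp : |p 1| ≤ Y) :
    shift (-⌊p 0⌋) p ∈ periodBox Y := by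
  rw [mem_periodBox]
  have h1 := Int.floor_le (p 0)
  have h2 := Int.lt_floor_add_one (p 0)
  refine ⟨⟨?_, ?_⟩, by simpa using hp⟩ <;> simp <;> linarith

theorem exists_speed_bounds (Y : ℝ) (hY : 0 ≤ Y) : ∃ m > 0, ∃ B > 0, ∀ p v : V2, |p 1| ≤ Y →
    m * ‖v‖ ≤ C.M.speed p v ∧ C.M.speed p v ≤ B * ‖v‖ := by
  let F : V2 × V2 → ℝ := fun z => C.M.speed z.1 z.2
  have hF : Continuous F := C.M.continuous_speed
  obtain ⟨K, hKdef⟩ : ∃ K, K = periodBox Y ×ˢ Metric.sphere (0 : V2) 1 := ⟨_, rfl⟩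
  have hK : IsCompact K := hKdef ▸ (isCompact_periodBox Y).prod (isCompact_sphere _ _)
  have hne : K.Nonempty := by
    refine ⟨(0, Pi.single 0 1), ?_⟩
    rw [hKdef, mem_prod, mem_periodBox, mem_sphere_zero_iff_norm]
    exact ⟨by simpa using hY, norm_single_zero⟩
  obtain ⟨z₁, hz₁, h₁⟩ := hK.exists_isMinOn hne hF.continuousOn
  obtain ⟨z₂, hz₂, h₂⟩ := hK.exists_isMaxOn hne hF.continuousOn
  have hpos : ∀ z ∈ K, 0 < F z := by
    intro z hz
    rw [hKdef] at hz
    refine C.M.speed_pos _ fun h0 => ?_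
    have := mem_sphere_zero_iff_norm.1 hz.2
    rw [h0, norm_zero] at this
    exact zero_ne_one this
  refine ⟨F z₁, hpos _ hz₁, F z₂, hpos _ hz₂, fun p v hp => ?_⟩
  rcases eq_or_ne v 0 with rfl | hv
  · have h0 : C.M.speed p 0 = 0 := by
      rw [← zero_smul ℝ (0 : V2), C.M.speed_smul, abs_zero, zero_mul]
    rw [h0, norm_zero, mul_zero, mul_zero]
    exact ⟨le_rfl, le_rfl⟩
  have hv' : ‖v‖ ≠ 0 := norm_ne_zero_iff.2 hv
  have hmem : (shift (-⌊p 0⌋) p, ‖v‖⁻¹ • v) ∈ K := by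
    rw [hKdef]
    refine ⟨shift_floor_mem_periodBox hp, mem_sphere_zero_iff_norm.2 ?_⟩
    rw [norm_smul, norm_inv, norm_norm, inv_mul_cancel₀ hv']
  have e : C.M.speed p v = F (shift (-⌊p 0⌋) p, ‖v‖⁻¹ • v) * ‖v‖ := by
    change _ = C.M.speed (shift (-⌊p 0⌋) p) (‖v‖⁻¹ • v) * ‖v‖
    rw [C.speed_shift, C.M.speed_smul, abs_inv, abs_norm]
    field_simp
  rw [e]
  exact ⟨mul_le_mul_of_nonneg_right (isMinOn_iff.1 h₁ _ hmem) (norm_nonneg _),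
    mul_le_mul_of_nonneg_right (isMaxOn_iff.1 h₂ _ hmem) (norm_nonneg _)⟩

theorem exists_dist_le (Y : ℝ) (hY : 0 ≤ Y) : ∃ B > 0, ∀ p q : V2, |p 1| ≤ Y → |q 1| ≤ Y →
    C.M.dist p q ≤ B * ‖p - q‖ := by
  obtain ⟨_, _, B, hB, h⟩ := C.exists_speed_bounds Y hY
  refine ⟨B, hB, fun p q hp hq => ?_⟩
  have h1 := C.M.dist_le_curveLen_unit (RMetric.contDiff_segment p q)
  have h2 : C.M.curveLen (fun t : ℝ => p + t • (q - p)) 0 1 ≤ ∫ _ in (0 : ℝ)..1, B * ‖p - q‖ := by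
    refine intervalIntegral.integral_mono_on zero_le_one
      ((C.M.continuous_speed_vel (RMetric.contDiff_segment p q)).intervalIntegrable _ _)
      (by simp) fun t ht => ?_
    have hv : vel (fun t : ℝ => p + t • (q - p)) t = q - p := by
      refine HasDerivAt.vel_eq ?_
      simpa using ((hasDerivAt_id t).smul_const (q - p)).const_add p
    change C.M.speed _ (vel (fun t : ℝ => p + t • (q - p)) t) ≤ _
    rw [hv, norm_sub_rev]
    refine (h _ _ ?_).2
    rw [abs_le] at *
    simp only [Pi.add_apply, Pi.smul_apply, Pi.sub_apply, smul_eq_mul]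
    constructor <;> nlinarith [ht.1, ht.2]
  simp at h1 h2
  linarith

theorem exists_le_dist (Y : ℝ) (hY : 0 ≤ Y) : ∃ m > 0, ∀ p q : V2, |p 1| ≤ Y →
    m * min 1 ‖p - q‖ ≤ C.M.dist p q := by
  obtain ⟨m, hm, _, _, h⟩ := C.exists_speed_bounds (Y + 1) (by linarith)
  refine ⟨m, hm, fun p q hp => C.M.le_dist fun γ hγ h0 h1 => ?_⟩
  set ρ := min 1 ‖p - q‖
  have hK : IsCompact {t ∈ Icc (0 : ℝ) 1 | ρ ≤ ‖γ t - p‖} := by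
    have : IsClosed {t : ℝ | ρ ≤ ‖γ t - p‖} :=
      isClosed_le continuous_const (hγ.continuous.sub continuous_const).norm
    exact isCompact_Icc.inter_right this
  obtain ⟨s, ⟨hs, hρs⟩, hmin⟩ := hK.exists_isLeast
    ⟨1, right_mem_Icc.2 zero_le_one, by rw [h1, norm_sub_rev]; exact min_le_right _ _⟩
  have hlen : C.M.curveLen γ 0 s ≤ C.M.curveLen γ 0 1 := by
    have := C.M.curveLen_add hγ 0 s 1
    have := C.M.curveLen_nonneg γ hs.2
    linarith
  have hint : ∫ t in (0 : ℝ)..s, vel γ t = γ s - γ 0 :=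
    intervalIntegral.integral_eq_sub_of_hasDerivAt
      (fun t _ => hasDerivAt_vel (hγ.differentiable one_ne_zero t))
      ((continuous_vel hγ).intervalIntegrable _ _)
  calc m * ρ ≤ m * ‖γ s - γ 0‖ := by rw [h0]; gcongr
    _ ≤ m * ∫ t in (0 : ℝ)..s, ‖vel γ t‖ := by
      rw [← hint]
      gcongr
      exact intervalIntegral.norm_integral_le_integral_norm hs.1
    _ = ∫ t in (0 : ℝ)..s, m * ‖vel γ t‖ := by rw [intervalIntegral.integral_const_mul]
    _ ≤ C.M.curveLen γ 0 s := by
      refine intervalIntegral.integral_mono_on_of_le_Ioo hs.1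
        ((continuous_const.mul (continuous_vel hγ).norm).intervalIntegrable _ _)
        ((C.M.continuous_speed_vel hγ).intervalIntegrable _ _) fun t ht => (h _ _ ?_).1
      have hlt : ‖γ t - p‖ < ρ := by
        by_contra hcon
        exact absurd (hmin ⟨⟨ht.1.le, ht.2.le.trans hs.2⟩, not_lt.1 hcon⟩) (not_le.2 ht.2)
      have h3 : |γ t 1 - p 1| ≤ 1 :=
        (norm_le_pi_norm (γ t - p) 1).trans (hlt.le.trans (min_le_left _ _))
      have := abs_sub_abs_le_abs_sub (γ t 1) (p 1)
      linarith
    _ ≤ C.M.curveLen γ 0 1 := hlen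

theorem continuous_dist : Continuous fun z : V2 × V2 => C.M.dist z.1 z.2 := by
  rw [continuous_iff_continuousAt]
  intro z
  obtain ⟨B, hB, h⟩ := C.exists_dist_le (‖z‖ + 1) (by positivity)
  have hev : ∀ᶠ w in nhds z, ‖C.M.dist w.1 w.2 - C.M.dist z.1 z.2‖ ≤
      B * ‖w.1 - z.1‖ + B * ‖w.2 - z.2‖ := by
    filter_upwards [Metric.ball_mem_nhds z one_pos] with w hw
    have hwz : ‖w‖ ≤ ‖z‖ + 1 := by
      have := norm_sub_norm_le w z
      rw [Metric.mem_ball, dist_eq_norm] at hw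
      linarith
    have a1 : |w.1 1| ≤ ‖z‖ + 1 := (norm_le_pi_norm w.1 1).trans ((norm_fst_le w).trans hwz)
    have a2 : |w.2 1| ≤ ‖z‖ + 1 := (norm_le_pi_norm w.2 1).trans ((norm_snd_le w).trans hwz)
    have a3 : |z.1 1| ≤ ‖z‖ + 1 :=
      (norm_le_pi_norm z.1 1).trans ((norm_fst_le z).trans (by linarith))
    have a4 : |z.2 1| ≤ ‖z‖ + 1 :=
      (norm_le_pi_norm z.2 1).trans ((norm_snd_le z).trans (by linarith))
    have b1 := h _ _ a1 a3
    have b2 := h _ _ a2 a4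
    have c1 := C.M.dist_triangle w.1 z.1 w.2
    have c2 := C.M.dist_triangle z.1 z.2 w.2
    have c3 := C.M.dist_triangle z.1 w.1 z.2
    have c4 := C.M.dist_triangle w.1 w.2 z.2
    rw [C.M.dist_comm z.2 w.2] at c2
    rw [C.M.dist_comm z.1 w.1] at c3
    rw [Real.norm_eq_abs, abs_le]
    constructor <;> linarith
  rw [ContinuousAt, tendsto_iff_norm_sub_tendsto_zero]
  refine squeeze_zero' (Eventually.of_forall fun _ => norm_nonneg _) hev ?_
  have : Continuous fun w : V2 × V2 => B * ‖w.1 - z.1‖ + B * ‖w.2 - z.2‖ := by fun_prop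
  simpa using this.tendsto z

theorem bddBelow_range_dist (p q : V2) : BddBelow (range fun n : ℤ => C.M.dist p (shift n q)) :=
  ⟨0, by rintro _ ⟨n, rfl⟩; exact C.M.dist_nonneg _ _⟩

theorem cdist_le (p q : V2) (n : ℤ) : C.cdist p q ≤ C.M.dist p (shift n q) :=
  ciInf_le (C.bddBelow_range_dist p q) n

theorem cdist_le_dist (p q : V2) : C.cdist p q ≤ C.M.dist p q := by
  simpa using C.cdist_le p q 0

theorem le_cdist {p q : V2} {c : ℝ} (h : ∀ n, c ≤ C.M.dist p (shift n q)) : c ≤ C.cdist p q :=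
  le_ciInf h

theorem exists_dist_shift_lt {p q : V2} {c : ℝ} (h : C.cdist p q < c) :
    ∃ n, C.M.dist p (shift n q) < c := exists_lt_of_ciInf_lt h

theorem cdist_nonneg (p q : V2) : 0 ≤ C.cdist p q := C.le_cdist fun _ => C.M.dist_nonneg _ _

@[simp] theorem cdist_self (p : V2) : C.cdist p p = 0 :=
  le_antisymm ((C.cdist_le_dist p p).trans (C.M.dist_self p).le) (C.cdist_nonneg p p)

theorem dist_shift_left (n : ℤ) (p q : V2) :
    C.M.dist (shift n p) q = C.M.dist p (shift (-n) q) := by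
  rw [← C.dist_shift_shift n p, shift_shift_neg]

theorem cdist_comm_le (p q : V2) : C.cdist p q ≤ C.cdist q p := C.le_cdist fun n => by
  rw [C.M.dist_comm, C.dist_shift_left]
  exact C.cdist_le _ _ _

theorem cdist_comm (p q : V2) : C.cdist p q = C.cdist q p :=
  le_antisymm (C.cdist_comm_le p q) (C.cdist_comm_le q p)

theorem cdist_triangle (p q s : V2) : C.cdist p s ≤ C.cdist p q + C.cdist q s := by
  refine le_of_forall_pos_le_add fun ε hε => ?_
  obtain ⟨m, hm⟩ := C.exists_dist_shift_lt (lt_add_of_pos_right (C.cdist p q) (half_pos hε))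
  obtain ⟨n, hn⟩ := C.exists_dist_shift_lt (lt_add_of_pos_right (C.cdist q s) (half_pos hε))
  rw [← C.dist_shift_shift m, shift_shift] at hn
  have h1 := C.M.dist_triangle p (shift m q) (shift (m + n) s)
  have h2 := C.cdist_le p s (m + n)
  linarith

@[simp] theorem cdist_shift_right (p q : V2) (n : ℤ) : C.cdist p (shift n q) = C.cdist p q := by
  refine le_antisymm (C.le_cdist fun k => ?_) (C.le_cdist fun k => ?_)
  · have := C.cdist_le p (shift n q) (k - n)
    rwa [shift_shift, sub_add_cancel] at this
  · rw [shift_shift]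
    exact C.cdist_le _ _ _

@[simp] theorem cdist_shift_left (p q : V2) (n : ℤ) : C.cdist (shift n p) q = C.cdist p q := by
  rw [C.cdist_comm, cdist_shift_right, C.cdist_comm]

theorem continuous_cdist : Continuous fun z : V2 × V2 => C.cdist z.1 z.2 := by
  rw [continuous_iff_continuousAt]
  intro z
  rw [ContinuousAt, tendsto_iff_norm_sub_tendsto_zero]
  have hc := C.continuous_dist
  have : Continuous fun w : V2 × V2 => C.M.dist w.1 z.1 + C.M.dist w.2 z.2 :=
    (hc.comp (continuous_fst.prodMk continuous_const)).add
      (hc.comp (continuous_snd.prodMk continuous_const))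
  have ht := this.tendsto z
  simp only [C.M.dist_self, add_zero] at ht
  refine squeeze_zero (fun _ => norm_nonneg _) (fun w => ?_) ht
  have b1 := C.cdist_le_dist w.1 z.1
  have b2 := C.cdist_le_dist w.2 z.2
  have c1 := C.cdist_triangle w.1 z.1 w.2
  have c2 := C.cdist_triangle z.1 z.2 w.2
  have c3 := C.cdist_triangle z.1 w.1 z.2
  have c4 := C.cdist_triangle w.1 w.2 z.2
  rw [C.cdist_comm z.2 w.2] at c2
  rw [C.cdist_comm z.1 w.1] at c3
  rw [Real.norm_eq_abs, abs_le]
  constructor <;> linarith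

theorem loopLen_le (p : V2) {n : ℤ} (hn : n ≠ 0) : C.loopLen p ≤ C.M.dist p (shift n p) :=
  ciInf_le (f := fun n : {n : ℤ // n ≠ 0} => C.M.dist p (shift n.1 p))
    ⟨0, by rintro _ ⟨n, rfl⟩; exact C.M.dist_nonneg _ _⟩ ⟨n, hn⟩

theorem exists_cdist_le_cdist_le {o z : V2} {R η : ℝ} (hR : 0 ≤ R) (hη : 0 ≤ η)
    (h : C.cdist o z < R + η) : ∃ w, C.cdist o w ≤ R ∧ C.cdist w z ≤ η := by
  obtain ⟨n, hn⟩ := C.exists_dist_shift_lt h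
  obtain ⟨γ, hγ, h0, h1, hl⟩ := C.M.exists_curveLen_lt hn
  rcases le_or_gt (C.cdist o z) R with hz | hz
  · exact ⟨z, hz, by simpa using hη⟩
  have hlen : R ≤ C.M.curveLen γ 0 1 := by
    have := C.M.dist_le_curveLen_unit hγ
    rw [h0, h1] at this
    linarith [C.cdist_le o z n]
  have hc : Continuous fun t => C.M.curveLen γ 0 t :=
    intervalIntegral.continuous_primitive
      (fun a b => (C.M.continuous_speed_vel hγ).intervalIntegrable a b) 0
  have hF0 : C.M.curveLen γ 0 0 = 0 := intervalIntegral.integral_same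
  obtain ⟨t, ht, hFt⟩ := intermediate_value_Icc zero_le_one hc.continuousOn
    (show R ∈ Icc (C.M.curveLen γ 0 0) (C.M.curveLen γ 0 1) from ⟨by rwa [hF0], hlen⟩)
  have hFt : C.M.curveLen γ 0 t = R := hFt
  refine ⟨γ t, ?_, ?_⟩
  · have := C.M.dist_le_curveLen hγ ht.1
    rw [h0, hFt] at this
    exact (C.cdist_le_dist _ _).trans this
  · have h2 := C.M.dist_le_curveLen hγ ht.2
    rw [h1] at h2
    have h3 := C.M.curveLen_add hγ 0 t 1
    linarith [C.cdist_le (γ t) z n]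

theorem exists_le_cdist (Y : ℝ) (hY : 0 ≤ Y) : ∃ m > 0, ∀ p q : V2, |p 1| ≤ Y →
    m * min 1 |p 1 - q 1| ≤ C.cdist p q := by
  obtain ⟨m, hm, h⟩ := C.exists_le_dist Y hY
  refine ⟨m, hm, fun p q hp => C.le_cdist fun n => le_trans ?_ (h p (shift n q) hp)⟩
  have : |p 1 - q 1| ≤ ‖p - shift n q‖ := by
    simpa using norm_le_pi_norm (p - shift n q) 1
  gcongr

/-- The plane with the pseudo-distance of the cylinder. -/
def Space (_ : CylMetric) : Type := V2

noncomputable instance : PseudoMetricSpace C.Space where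
  dist p q := C.cdist p q
  dist_self p := C.cdist_self p
  dist_comm p q := C.cdist_comm p q
  dist_triangle p q s := C.cdist_triangle p q s

/-- The identity map from the plane to the cylinder pseudo-metric space. -/
def toSpace (p : V2) : C.Space := p

theorem surjective_toSpace : Function.Surjective C.toSpace := fun p => ⟨p, rfl⟩

theorem continuous_toSpace : Continuous C.toSpace := by
  rw [continuous_iff_continuousAt]
  intro p
  rw [ContinuousAt, tendsto_iff_dist_tendsto_zero]
  have : Continuous fun q => C.cdist q p :=
    C.continuous_cdist.comp (continuous_id.prodMk continuous_const)
  have ht := this.tendsto p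
  rwa [cdist_self] at ht

theorem completeSpace (h : C.Complete) : CompleteSpace C.Space := by
  refine Metric.complete_of_cauchySeq_tendsto fun u hu => ?_
  obtain ⟨p, hp⟩ := h u (Metric.cauchySeq_iff.1 hu)
  exact ⟨p, tendsto_iff_dist_tendsto_zero.2 hp⟩

theorem totallyBounded_closedBall {o : V2} {ρ : ℝ} (hρ : 0 < ρ)
    (h : ∀ R < ρ, ∃ Y, ∀ q, C.cdist o q ≤ R → |q 1| ≤ Y) :
    TotallyBounded (Metric.closedBall (C.toSpace o) ρ) := by
  rw [Metric.totallyBounded_iff]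
  intro ε hε
  have hR : max 0 (ρ - ε / 3) < ρ := max_lt hρ (by linarith)
  obtain ⟨Y, hY⟩ := h _ hR
  have hK := ((isCompact_periodBox Y).image C.continuous_toSpace).totallyBounded
  obtain ⟨t, ht, hKt⟩ := Metric.totallyBounded_iff.1 hK (ε / 2) (by linarith)
  refine ⟨t, ht, fun q hq => ?_⟩
  obtain ⟨q, rfl⟩ := C.surjective_toSpace q
  have hq : C.cdist q o ≤ ρ := hq
  rw [C.cdist_comm] at hq
  obtain ⟨w, hw1, hw2⟩ := C.exists_cdist_le_cdist_le (le_max_left 0 (ρ - ε / 3))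
    (η := ε / 2) (by linarith) (lt_of_le_of_lt hq (by linarith [le_max_right 0 (ρ - ε / 3)]))
  have hmem := hKt ⟨_, shift_floor_mem_periodBox (hY w hw1), rfl⟩
  simp only [mem_iUnion, exists_prop] at hmem ⊢
  obtain ⟨y, hy, hwy⟩ := hmem
  refine ⟨y, hy, ?_⟩
  obtain ⟨y, rfl⟩ := C.surjective_toSpace y
  have hwy : C.cdist (shift (-⌊w 0⌋) w) y < ε / 2 := hwy
  rw [cdist_shift_left] at hwy
  change C.cdist q y < ε
  have := C.cdist_triangle q w y
  rw [C.cdist_comm q w] at this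
  linarith

/-- Closed metric balls of a complete cylinder have bounded height. -/
theorem exists_height_bound (hC : C.Complete) (o : V2) (R : ℝ) :
    ∃ Y, ∀ q, C.cdist o q ≤ R → |q 1| ≤ Y := by
  let A : Set ℝ := {R | ∃ Y, ∀ q, C.cdist o q ≤ R → |q 1| ≤ Y}
  have hdown : ∀ {R R'}, R' ≤ R → R ∈ A → R' ∈ A := fun hle ⟨Y, hY⟩ =>
    ⟨Y, fun q hq => hY q (hq.trans hle)⟩
  have hloc : ∀ Y ≥ 0, ∃ m > 0, ∀ p q : V2, |p 1| ≤ Y → C.cdist p q < m → |q 1| ≤ Y + 1 := by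
    intro Y hY
    obtain ⟨m, hm, h⟩ := C.exists_le_cdist Y hY
    refine ⟨m, hm, fun p q hp hpq => ?_⟩
    have h1 := (h p q hp).trans_lt hpq
    have h2 : min 1 |p 1 - q 1| < 1 := by
      by_contra hcon
      nlinarith [not_lt.1 hcon]
    have h3 : |p 1 - q 1| < 1 := by simpa using h2
    have := abs_sub_abs_le_abs_sub (q 1) (p 1)
    rw [abs_sub_comm] at this
    linarith
  obtain ⟨m₀, hm₀, h₀⟩ := hloc |o 1| (abs_nonneg _)
  have hA0 : m₀ / 2 ∈ A := ⟨_, fun q hq => h₀ o q le_rfl (by linarith)⟩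
  by_contra hR
  have hR : R ∉ A := hR
  have hbdd : BddAbove A := ⟨R, fun x hx => le_of_not_ge fun hle => hR (hdown hle hx)⟩
  set ρ := sSup A with hρdef
  have hρ : 0 < ρ := lt_of_lt_of_le (by linarith) (le_csSup hbdd hA0)
  have hlt : ∀ R < ρ, R ∈ A := fun R hR => by
    obtain ⟨x, hx, hRx⟩ := exists_lt_of_lt_csSup ⟨_, hA0⟩ hR
    exact hdown hRx.le hx
  have hρA : ρ ∉ A := by
    rintro ⟨Y, hY⟩
    obtain ⟨m, hm, h⟩ := hloc |Y| (abs_nonneg _)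
    have : ρ + m / 4 ∈ A := by
      refine ⟨|Y| + 1, fun q hq => ?_⟩
      obtain ⟨w, hw1, hw2⟩ := C.exists_cdist_le_cdist_le hρ.le (η := m / 2) (by linarith)
        (lt_of_le_of_lt hq (by linarith))
      exact h w q ((hY w hw1).trans (le_abs_self Y)) (by linarith)
    linarith [le_csSup hbdd this]
  have hseq : ∀ n : ℕ, ∃ q, C.cdist o q ≤ ρ ∧ (n : ℝ) < |q 1| := by
    intro n
    by_contra! hcon
    exact hρA ⟨n, hcon⟩
  choose q hq hqn using hseq
  have := C.completeSpace hC
  have hcpt : IsCompact (Metric.closedBall (C.toSpace o) ρ) :=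
    isCompact_iff_totallyBounded_isComplete.2
      ⟨C.totallyBounded_closedBall hρ hlt, Metric.isClosed_closedBall.isComplete⟩
  obtain ⟨p, -, φ, hφ, hlim⟩ := hcpt.tendsto_subseq (x := fun n => C.toSpace (q n)) fun n => by
    change C.cdist (q n) o ≤ ρ
    rw [C.cdist_comm]
    exact hq n
  obtain ⟨p, rfl⟩ := C.surjective_toSpace p
  obtain ⟨m, hm, h⟩ := hloc |p 1| (abs_nonneg _)
  have h1 := (tendsto_iff_dist_tendsto_zero.1 hlim).eventually (gt_mem_nhds hm)
  obtain ⟨N, hN⟩ := exists_nat_gt (|p 1| + 1)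
  obtain ⟨n, hn1, hn2⟩ := (h1.and (eventually_ge_atTop N)).exists
  have hn1 : C.cdist (q (φ n)) p < m := hn1
  rw [C.cdist_comm] at hn1
  have h2 := h p _ le_rfl hn1
  have h3 := hqn (φ n)
  have h4 : (N : ℝ) ≤ φ n := by exact_mod_cast hn2.trans (hφ.id_le n)
  linarith

end CylMetric

/-- The covering map from the plane to the punctured plane. -/
noncomputable def cylExp (σ : ℝ) (q : V2) : ℂ :=
  (Real.exp (2 * π * (σ * q 1)) : ℝ) * Complex.exp ((2 * π * q 0 : ℝ) * Complex.I)

theorem norm_cylExp (σ : ℝ) (q : V2) : ‖cylExp σ q‖ = Real.exp (2 * π * (σ * q 1)) := by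
  rw [cylExp, norm_mul, Complex.norm_exp_ofReal_mul_I, mul_one, Complex.norm_real,
    Real.norm_eq_abs, abs_of_pos (Real.exp_pos _)]

theorem isArg_cylExp (σ : ℝ) (q : V2) : IsArg (cylExp σ q) (2 * π * q 0) := by
  rw [IsArg, norm_cylExp, cylExp]

theorem cylExp_ne_zero (σ : ℝ) (q : V2) : cylExp σ q ≠ 0 := by
  rw [← norm_pos_iff, norm_cylExp]
  exact Real.exp_pos _

theorem continuous_cylExp (σ : ℝ) : Continuous (cylExp σ) := by
  unfold cylExp
  fun_prop

theorem norm_cylExp_lt {σ : ℝ} {p q : V2} :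
    ‖cylExp σ p‖ < ‖cylExp σ q‖ ↔ σ * p 1 < σ * q 1 := by
  rw [norm_cylExp, norm_cylExp, Real.exp_lt_exp]
  exact mul_lt_mul_iff_right₀ Real.two_pi_pos

theorem IsArg.exists_int {z : ℂ} (hz : z ≠ 0) {θ φ : ℝ} (h : IsArg z θ) (k : IsArg z φ) :
    ∃ n : ℤ, θ = φ + n * (2 * π) := by
  have hn : (‖z‖ : ℂ) ≠ 0 := by exact_mod_cast norm_ne_zero_iff.2 hz
  have h1 : Complex.exp (θ * Complex.I) = Complex.exp (φ * Complex.I) :=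
    mul_left_cancel₀ hn (h.symm.trans k)
  obtain ⟨n, hn⟩ := Complex.exp_eq_exp_iff_exists_int.1 h1
  refine ⟨n, ?_⟩
  have h2 : (θ : ℂ) * Complex.I = ((φ + n * (2 * π) : ℝ) : ℂ) * Complex.I := by
    rw [hn]
    push_cast
    ring
  exact_mod_cast mul_right_cancel₀ Complex.I_ne_zero h2

theorem cylExp_shift (σ : ℝ) (n : ℤ) (q : V2) : cylExp σ (shift n q) = cylExp σ q := by
  have : ((2 * π * (q 0 + n) : ℝ) : ℂ) * Complex.I =
      ((2 * π * q 0 : ℝ) : ℂ) * Complex.I + n * (2 * π * Complex.I) := by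
    push_cast
    ring
  rw [cylExp, cylExp, shift_apply_zero, shift_apply_one, this, Complex.exp_add,
    Complex.exp_int_mul_two_pi_mul_I, mul_one]

theorem exists_first_hit {g : ℝ → ℝ} {a b v : ℝ} (hab : a ≤ b) (hg : ContinuousOn g (Icc a b))
    (ha : v < g a) (hb : g b < v) : ∃ t ∈ Ioo a b, g t = v ∧ ∀ s ∈ Icc a t, v ≤ g s := by
  have hK : IsCompact {t ∈ Icc a b | g t ≤ v} :=
    isCompact_Icc.of_isClosed_subset
      (hg.preimage_isClosed_of_isClosed isClosed_Icc isClosed_Iic) inter_subset_left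
  obtain ⟨t, ⟨ht, htv⟩, hmin⟩ := hK.exists_isLeast ⟨b, right_mem_Icc.2 hab, hb.le⟩
  have htv' : g t = v := by
    obtain ⟨s, hs, hsv⟩ := intermediate_value_Icc' ht.1 (hg.mono (Icc_subset_Icc_right ht.2))
      (show v ∈ Icc (g t) (g a) from ⟨htv, ha.le⟩)
    rwa [le_antisymm hs.2 (hmin ⟨⟨hs.1, hs.2.trans ht.2⟩, hsv.le⟩)] at hsv
  refine ⟨t, ⟨lt_of_le_of_ne ht.1 fun h => ?_, lt_of_le_of_ne ht.2 fun h => ?_⟩, htv',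
    fun s hs => ?_⟩
  · rw [h] at ha
    exact ha.ne' htv'
  · rw [← h] at hb
    exact hb.ne htv'
  · by_contra! hcon
    rw [le_antisymm hs.2 (hmin ⟨⟨hs.1, hs.2.trans ht.2⟩, hcon.le⟩)] at hcon
    exact hcon.ne htv'

theorem exists_last_hit {g : ℝ → ℝ} {a b v : ℝ} (hab : a ≤ b) (hg : ContinuousOn g (Icc a b))
    (ha : g a < v) (hb : v < g b) : ∃ t ∈ Ioo a b, g t = v ∧ ∀ s ∈ Icc t b, v ≤ g s := by
  obtain ⟨t, ht, htv, hs⟩ := exists_first_hit (g := fun t => g (-t)) (neg_le_neg hab)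
    (hg.comp continuous_neg.continuousOn fun x hx => ⟨by linarith [hx.2], by linarith [hx.1]⟩)
    (v := v) (by simpa using hb) (by simpa using ha)
  refine ⟨-t, ⟨by linarith [ht.2], by linarith [ht.1]⟩, htv, fun s hs' => ?_⟩
  simpa using hs (-s) ⟨by linarith [hs'.2], by linarith [hs'.1]⟩

/-- A path through `P` can be modified to cross a small disc around `P` along a chord. -/
theorem exists_path_with_chord {Γ : ℝ → ℂ} {r R v : ℝ} (hr : r ∈ Icc 0 R)
    (hΓ : ContinuousOn Γ (Icc 0 R)) (hv : 0 < v) (h0 : v < ‖Γ 0 - Γ r‖) (hR : v < ‖Γ R - Γ r‖) :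
    ∃ t₁ t₂, t₁ ∈ Ioo 0 r ∧ t₂ ∈ Ioo r R ∧ ‖Γ t₁ - Γ r‖ = v ∧ ‖Γ t₂ - Γ r‖ = v ∧
      ∃ Γ' : Path (Γ 0) (Γ R), ∀ w ∈ range Γ', w ∈ segment ℝ (Γ t₁) (Γ t₂) ∨
        (v ≤ ‖w - Γ r‖ ∧ ∃ t ∈ Icc 0 R, t ≠ r ∧ w = Γ t) := by
  have hg : ContinuousOn (fun t => ‖Γ t - Γ r‖) (Icc 0 R) := (hΓ.sub continuousOn_const).norm
  obtain ⟨t₁, ht₁, hv₁, h₁⟩ := exists_first_hit hr.1 (hg.mono (Icc_subset_Icc_right hr.2)) h0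
    (by simpa using hv)
  obtain ⟨t₂, ht₂, hv₂, h₂⟩ := exists_last_hit hr.2 (hg.mono (Icc_subset_Icc_left hr.1))
    (by simpa using hv) hR
  refine ⟨t₁, t₂, ht₁, ht₂, hv₁, hv₂, ?_⟩
  have hpath : ∀ {a b : ℝ}, 0 ≤ a → a ≤ b → b ≤ R → JoinedIn (Γ '' Icc a b) (Γ a) (Γ b) := by
    intro a b ha hab hb
    have := ((convex_Icc a b).isPathConnected (nonempty_Icc.2 hab)).image'
      (hΓ.mono (Icc_subset_Icc ha hb))
    exact this.joinedIn _ (mem_image_of_mem _ (left_mem_Icc.2 hab)) _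
      (mem_image_of_mem _ (right_mem_Icc.2 hab))
  let G : Set ℂ := Γ '' Icc 0 t₁ ∪ segment ℝ (Γ t₁) (Γ t₂) ∪ Γ '' Icc t₂ R
  have j₁ : JoinedIn G (Γ 0) (Γ t₁) :=
    (hpath le_rfl ht₁.1.le (ht₁.2.le.trans hr.2)).mono fun w hw => Or.inl (Or.inl hw)
  have j₂ : JoinedIn G (Γ t₁) (Γ t₂) :=
    JoinedIn.of_segment_subset fun w hw => Or.inl (Or.inr hw)
  have j₃ : JoinedIn G (Γ t₂) (Γ R) :=
    (hpath (hr.1.trans ht₂.1.le) ht₂.2.le le_rfl).mono fun w hw => Or.inr hw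
  obtain ⟨Γ', hΓ'⟩ := (j₁.trans j₂).trans j₃
  refine ⟨Γ', ?_⟩
  rintro _ ⟨t, rfl⟩
  rcases hΓ' t with (⟨s, hs, hsw⟩ | hw) | ⟨s, hs, hsw⟩
  · exact Or.inr ⟨hsw ▸ h₁ s hs, s, ⟨hs.1, hs.2.trans (ht₁.2.le.trans hr.2)⟩,
      (hs.2.trans_lt ht₁.2).ne, hsw.symm⟩
  · exact Or.inl hw
  · exact Or.inr ⟨hsw ▸ h₂ s hs, s, ⟨hr.1.trans (ht₂.1.le.trans hs.1), hs.2⟩,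
      (ht₂.1.trans_le hs.1).ne', hsw.symm⟩

/-- A continuous integer valued function on a disc minus a chord takes at most two values. -/
theorem exists_two_values_of_chord {P a b : ℂ} {v : ℝ} (ha : ‖a - P‖ = v) (hb : ‖b - P‖ = v)
    (hab : a ≠ b) {n : ℂ → ℤ} (hn : ContinuousOn n (Metric.ball P v \ segment ℝ a b)) :
    ∃ n₁ n₂, ∀ w ∈ Metric.ball P v \ segment ℝ a b, n w = n₁ ∨ n w = n₂ := by
  let ℓ : ℂ → ℝ := fun w => ((w - a) * (starRingEnd ℂ) (b - a)).im
  have hℓ : ∀ x y : ℂ, ∀ s t : ℝ, s + t = 1 → ℓ (s • x + t • y) = s * ℓ x + t * ℓ y := by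
    intro x y s t hst
    obtain rfl : s = 1 - t := by linarith
    simp only [ℓ, Complex.mul_im, Complex.sub_re, Complex.sub_im, Complex.add_re, Complex.add_im,
      Complex.conj_re, Complex.conj_im, Complex.smul_re, Complex.smul_im, smul_eq_mul, map_sub]
    ring
  have hℓseg : ∀ w ∈ segment ℝ a b, ℓ w = 0 := by
    rintro _ ⟨s, t, -, -, hst, rfl⟩
    rw [hℓ _ _ _ _ hst]
    simp only [ℓ, sub_self, zero_mul, Complex.zero_im, Complex.mul_conj, Complex.ofReal_im,
      mul_zero, add_zero]
  have hline : ∀ w ∈ Metric.ball P v, ℓ w = 0 → w ∈ segment ℝ a b := by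
    intro w hw hw0
    rw [mem_ball_iff_norm] at hw
    have hba : b - a ≠ 0 := sub_ne_zero.2 hab.symm
    let t : ℝ := ((w - a) * (starRingEnd ℂ) (b - a)).re / Complex.normSq (b - a)
    have hwt : w = a + t * (b - a) := by
      have e1 : (w - a) * (starRingEnd ℂ) (b - a) =
          ((((w - a) * (starRingEnd ℂ) (b - a)).re : ℝ) : ℂ) :=
        Complex.ext (Complex.ofReal_re _).symm (hw0.trans (Complex.ofReal_im _).symm)
      have e2 : (Complex.normSq (b - a) : ℂ) ≠ 0 := by
        exact_mod_cast (Complex.normSq_pos.2 hba).ne'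
      have e3 : (t : ℂ) * (b - a) = w - a := by
        simp only [t]
        push_cast
        rw [← e1, div_mul_eq_mul_div, mul_assoc, mul_comm ((starRingEnd ℂ) (b - a)),
          Complex.mul_conj, mul_div_assoc, div_self e2, mul_one]
      rw [e3]
      ring
    have key : ∀ {x y : ℂ} {μ : ℝ}, ‖x - P‖ < v → ‖y - P‖ = v → 0 < μ → μ ≤ 1 →
        ‖(μ * x + (1 - μ) * y) - P‖ < v := by
      intro x y μ hx hy h0 h1
      have : (μ * x + (1 - μ) * y) - P = (μ : ℂ) * (x - P) + ((1 - μ : ℝ) : ℂ) * (y - P) := by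
        push_cast
        ring
      rw [this]
      refine (norm_add_le _ _).trans_lt ?_
      rw [norm_mul, norm_mul, Complex.norm_real, Complex.norm_real, Real.norm_eq_abs,
        Real.norm_eq_abs, abs_of_pos h0, abs_of_nonneg (by linarith), hy]
      nlinarith
    have ht0 : 0 ≤ t := by
      by_contra! hcon
      have := key (μ := (1 - t)⁻¹) hw hb (inv_pos.2 (by linarith))
        (inv_le_one_of_one_le₀ (by linarith))
      have ht : (1 - t : ℂ) ≠ 0 := by
        have : (1 - t : ℝ) ≠ 0 := by linarith
        exact_mod_cast this
      have e : (((1 - t)⁻¹ : ℝ) : ℂ) * w + (1 - (((1 - t)⁻¹ : ℝ) : ℂ)) * b = a := by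
        rw [hwt]
        push_cast
        field_simp
        ring
      rw [e, ha] at this
      exact lt_irrefl _ this
    have ht1 : t ≤ 1 := by
      by_contra! hcon
      have := key (μ := t⁻¹) hw ha (inv_pos.2 (by linarith)) (inv_le_one_of_one_le₀ hcon.le)
      have ht : (t : ℂ) ≠ 0 := by
        have : t ≠ 0 := by linarith
        exact_mod_cast this
      have e : ((t⁻¹ : ℝ) : ℂ) * w + (1 - ((t⁻¹ : ℝ) : ℂ)) * a = b := by
        rw [hwt]
        push_cast
        field_simp
        ring
      rw [e, hb] at this
      exact lt_irrefl _ this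
    refine ⟨1 - t, t, by linarith, ht0, by ring, ?_⟩
    rw [hwt]
    simp only [Complex.real_smul]
    push_cast
    ring
  have hconst : ∀ D : Set ℂ, Convex ℝ D → D ⊆ Metric.ball P v \ segment ℝ a b →
      ∃ m, ∀ w ∈ D, n w = m := by
    intro D hD hsub
    rcases D.eq_empty_or_nonempty with rfl | ⟨w₀, hw₀⟩
    · exact ⟨0, by simp⟩
    · exact ⟨n w₀, fun w hw => hD.isPreconnected.constant (hn.mono hsub) hw hw₀⟩
  have hpos : Convex ℝ {w | 0 < ℓ w} := by
    intro x hx y hy s t hs ht hst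
    change 0 < ℓ _
    rw [hℓ _ _ _ _ hst]
    rcases hs.eq_or_lt with rfl | hs
    · have : t = 1 := by linarith
      simpa [this] using hy
    · have hx : 0 < ℓ x := hx
      have hy : 0 < ℓ y := hy
      positivity
  have hneg : Convex ℝ {w | ℓ w < 0} := by
    intro x hx y hy s t hs ht hst
    change ℓ _ < 0
    rw [hℓ _ _ _ _ hst]
    have hx : ℓ x < 0 := hx
    have hy : ℓ y < 0 := hy
    rcases hs.eq_or_lt with rfl | hs
    · have : t = 1 := by linarith
      simpa [this] using hy
    · nlinarith
  obtain ⟨n₁, h₁⟩ := hconst _ ((convex_ball P v).inter hpos) fun w hw =>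
    ⟨hw.1, fun h => hw.2.ne' (hℓseg w h)⟩
  obtain ⟨n₂, h₂⟩ := hconst _ ((convex_ball P v).inter hneg) fun w hw =>
    ⟨hw.1, fun h => hw.2.ne (hℓseg w h)⟩
  refine ⟨n₁, n₂, fun w hw => ?_⟩
  rcases lt_trichotomy (ℓ w) 0 with h | h | h
  · exact Or.inr (h₂ w ⟨hw.1, h⟩)
  · exact absurd (hline w hw.1 h) hw.2
  · exact Or.inl (h₁ w ⟨hw.1, h⟩)

theorem exists_int_eq_of_isArg_cylExp {σ : ℝ} {q : V2} {a : ℝ}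
    (h : IsArg (cylExp σ q) (2 * π * a)) : ∃ n : ℤ, q 0 = a + n := by
  obtain ⟨n, hn⟩ := (isArg_cylExp σ q).exists_int (cylExp_ne_zero σ q) h
  refine ⟨n, mul_left_cancel₀ Real.two_pi_pos.ne' ?_⟩
  rw [hn]
  ring

theorem exists_shift_of_cylExp_eq {σ : ℝ} (hσ : σ * σ = 1) {p q : V2}
    (h : cylExp σ p = cylExp σ q) : ∃ n, q = shift n p := by
  obtain ⟨n, hn⟩ := exists_int_eq_of_isArg_cylExp (h ▸ isArg_cylExp σ p)
  refine ⟨n, v2_ext (by simpa using hn) ?_⟩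
  have hσ0 : σ ≠ 0 := fun h => by simp [h] at hσ
  have h1 : σ * p 1 = σ * q 1 :=
    le_antisymm (not_lt.1 fun hlt => (norm_cylExp_lt.2 hlt).ne (congrArg norm h.symm))
      (not_lt.1 fun hlt => (norm_cylExp_lt.2 hlt).ne (congrArg norm h))
  rw [shift_apply_one]
  exact (mul_left_cancel₀ hσ0 h1).symm

theorem continuousOn_round {X : Type*} [TopologicalSpace X] {u : X → ℝ} {A : Set X}
    (hu : ContinuousOn u A) (h : ∀ x ∈ A, ∃ k : ℤ, u x = k) :
    ContinuousOn (fun x => round (u x)) A := by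
  rw [Int.isClosedEmbedding_coe_real.isInducing.continuousOn_iff]
  refine hu.congr fun x hx => ?_
  obtain ⟨k, hk⟩ := h x hx
  simp [hk]

/-- Near the image of a point the covering map `cylExp` has a section, on which a given continuous
function that vanishes at the point is small. -/
theorem exists_local_section {σ : ℝ} (hσ : σ * σ = 1) (p : V2) {D : V2 → ℝ} (hD : Continuous D)
    (hDp : D p = 0) {ε : ℝ} (hε : 0 < ε) :
    ∃ v > 0, ∃ s : ℂ → ℝ, ContinuousOn s (Metric.ball (cylExp σ p) v) ∧
      (∀ w ∈ Metric.ball (cylExp σ p) v, IsArg w (2 * π * s w)) ∧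
      ∀ q, cylExp σ q ∈ Metric.ball (cylExp σ p) v → D ![s (cylExp σ q), q 1] < ε := by
  set P := cylExp σ p with hP
  have hP0 : P ≠ 0 := cylExp_ne_zero σ p
  have hslit : ∀ w ∈ Metric.ball P ‖P‖, w / P ∈ Complex.slitPlane := by
    intro w hw
    left
    have h1 : ‖w / P - 1‖ < 1 := by
      rw [div_sub_one hP0, norm_div, div_lt_one (norm_pos_iff.2 hP0)]
      exact mem_ball_iff_norm.1 hw
    have := (abs_lt.1 ((Complex.abs_re_le_norm _).trans_lt h1)).1
    simp only [Complex.sub_re, Complex.one_re] at this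
    linarith
  let s : ℂ → ℝ := fun w => p 0 + Complex.arg (w / P) / (2 * π)
  have hs : ContinuousOn s (Metric.ball P ‖P‖) := by
    intro w hw
    refine ContinuousAt.continuousWithinAt (continuousAt_const.add (ContinuousAt.div_const ?_ _))
    exact (Complex.continuousAt_arg (hslit w hw)).comp (f := fun w : ℂ => w / P) (by fun_prop)
  have hPmem : P ∈ Metric.ball P ‖P‖ := Metric.mem_ball_self (norm_pos_iff.2 hP0)
  have hlog : ∀ q : V2, σ * Real.log ‖cylExp σ q‖ / (2 * π) = q 1 := by
    intro q
    rw [norm_cylExp, Real.log_exp]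
    calc σ * (2 * π * (σ * q 1)) / (2 * π) = (σ * σ) * q 1 := by field_simp
      _ = q 1 := by rw [hσ, one_mul]
  let F : ℂ → V2 := fun w => ![s w, σ * Real.log ‖w‖ / (2 * π)]
  have hF : ContinuousAt F P := by
    refine continuousAt_pi.2 fun i => ?_
    fin_cases i
    · exact hs.continuousAt (Metric.isOpen_ball.mem_nhds hPmem)
    · exact ((continuousAt_const.mul (continuous_norm.continuousAt.log
        (norm_ne_zero_iff.2 hP0))).div_const _)
  have hFP : F P = p := v2_ext (by simp [F, s, div_self hP0]) (hlog p)
  have hev : ∀ᶠ w in nhds P, D (F w) < ε := by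
    have h1 : ContinuousAt (fun w => D (F w)) P := hD.continuousAt.comp hF
    exact h1.eventually_lt continuousAt_const (by rwa [hFP, hDp])
  obtain ⟨v, hv, hball⟩ := Metric.eventually_nhds_iff_ball.1 hev
  have hsub : Metric.ball P (min v ‖P‖) ⊆ Metric.ball P ‖P‖ :=
    Metric.ball_subset_ball (min_le_right _ _)
  refine ⟨min v ‖P‖, lt_min hv (norm_pos_iff.2 hP0), s, hs.mono hsub, fun w hw => ?_,
    fun q hq => ?_⟩
  · have := (isArg_cylExp σ p).mul (isArg_arg (w / P))
    rw [← hP, mul_div_cancel₀ w hP0] at this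
    convert this using 1
    simp only [s]
    field_simp
  · have := hball _ (Metric.ball_subset_ball (min_le_left _ _) hq)
    simpa only [F, hlog] using this

/-- A path along which `f` is the parameter cuts the level set `f = r` in a single point. Away
from this point the level set lifts to the plane, and the lift connects the point to its
translate. -/
theorem exists_lift_of_level_set {σ : ℝ} (hσ : σ * σ = 1) {f : V2 → ℝ} (hf : Continuous f)
    (hper : ∀ n q, f (shift n q) = f q) {r y₀ y₁ R : ℝ} (hy : y₀ < y₁)
    (hbot : ∀ q : V2, σ * q 1 = y₀ → f q < r) (htop : ∀ q : V2, σ * q 1 = y₁ → r < f q)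
    {γ : ℝ → V2} (hr : r ∈ Icc 0 R) (hγ : ContinuousOn (fun t => cylExp σ (γ t)) (Icc 0 R))
    (hγf : ∀ t ∈ Icc 0 R, f (γ t) = t) (h0 : σ * γ 0 1 < y₀) (h1 : y₁ < σ * γ R 1)
    (hp0 : y₀ ≤ σ * γ r 1) (hp1 : σ * γ r 1 ≤ y₁) {D : V2 → ℝ} (hD : Continuous D)
    (hDp : D (γ r) = 0) {L ε : ℝ} (hε : 0 < ε)
    (hL : ∀ n : ℤ, n ≠ 0 → ∀ q, L - D q ≤ D (shift n q)) :
    ∃ v > 0, ∃ Λ : V2 → V2,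
      ContinuousOn Λ {q | (f q = r ∧ y₀ ≤ σ * q 1 ∧ σ * q 1 ≤ y₁) ∧
        v ≤ ‖cylExp σ q - cylExp σ (γ r)‖} ∧
      (∀ n q, Λ (shift n q) = Λ q) ∧
      (∀ q, (f q = r ∧ y₀ ≤ σ * q 1 ∧ σ * q 1 ≤ y₁) →
        v ≤ ‖cylExp σ q - cylExp σ (γ r)‖ → ∃ n, Λ q = shift n q) ∧
      ∀ s ∈ Ioo ε (L - ε), ∃ q, (f q = r ∧ y₀ ≤ σ * q 1 ∧ σ * q 1 ≤ y₁) ∧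
        v ≤ ‖cylExp σ q - cylExp σ (γ r)‖ ∧ D (Λ q) = s := by
  obtain ⟨v₀, hv₀, sec, hsec, hsecA, hsecD⟩ := exists_local_section hσ (γ r) hD hDp hε
  have hR0 : 0 ≤ R := hr.1.trans hr.2
  have hn0 : ‖cylExp σ (γ 0)‖ < ‖cylExp σ (γ r)‖ := norm_cylExp_lt.2 (h0.trans_le hp0)
  have hn1 : ‖cylExp σ (γ r)‖ < ‖cylExp σ (γ R)‖ := norm_cylExp_lt.2 (hp1.trans_lt h1)
  set P := cylExp σ (γ r) with hP
  obtain ⟨v, hv, hvlt⟩ := exists_between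
    (lt_min hv₀ (lt_min (sub_pos.2 hn0) (sub_pos.2 hn1)))
  obtain ⟨hvv, hvlt⟩ := lt_min_iff.1 hvlt
  obtain ⟨hv0, hv1⟩ := lt_min_iff.1 hvlt
  have hfE : ∀ {q q'}, cylExp σ q = cylExp σ q' → f q = f q' := fun h => by
    obtain ⟨n, rfl⟩ := exists_shift_of_cylExp_eq hσ h
    rw [hper]
  obtain ⟨t₁, t₂, ht₁, ht₂, ha, hb, Γ, hΓ⟩ := exists_path_with_chord hr hγ hv
    (by
      have := norm_sub_norm_le P (cylExp σ (γ 0))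
      rw [norm_sub_rev] at this
      exact hv0.trans_le this)
    (hv1.trans_le (norm_sub_norm_le _ _))
  have mt₁ : t₁ ∈ Icc 0 R := ⟨ht₁.1.le, ht₁.2.le.trans hr.2⟩
  have mt₂ : t₂ ∈ Icc 0 R := ⟨hr.1.trans ht₂.1.le, ht₂.2.le⟩
  set a := cylExp σ (γ t₁) with ha'
  set b := cylExp σ (γ t₂) with hb'
  have hab : a ≠ b := fun h => by
    have := hfE h
    rw [hγf t₁ mt₁, hγf t₂ mt₂] at this
    linarith [ht₁.2, ht₂.1]
  obtain ⟨θ, hθc, hθ⟩ := exists_continuousOn_arg_annulus Γ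
  set Ω : Set ℂ := {w | ‖cylExp σ (γ 0)‖ < ‖w‖ ∧ ‖w‖ < ‖cylExp σ (γ R)‖ ∧ w ∉ range Γ} with hΩ
  let x : ℂ → ℝ := fun w => θ w / (2 * π)
  have hx : ContinuousOn x Ω := hθc.div_const _
  have hxA : ∀ w ∈ Ω, IsArg w (2 * π * x w) := fun w hw => by
    have := hθ w hw.1 hw.2.1 hw.2.2
    simp only [x]
    rwa [mul_div_cancel₀ _ Real.two_pi_pos.ne']
  have hballΩ : Metric.ball P v \ segment ℝ a b ⊆ Ω := by
    intro w hw
    have hwP := mem_ball_iff_norm.1 hw.1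
    have e1 := norm_sub_norm_le P w
    have e2 := norm_sub_norm_le w P
    rw [norm_sub_rev] at e1
    refine ⟨by linarith, by linarith, fun hmem => ?_⟩
    rcases hΓ w hmem with h | h
    · exact hw.2 h
    · exact absurd h.1 (not_le.2 hwP)
  let S : Set V2 := {q | f q = r ∧ y₀ ≤ σ * q 1 ∧ σ * q 1 ≤ y₁}
  have hSΩ : ∀ q ∈ S, cylExp σ q ∉ segment ℝ a b → cylExp σ q ∈ Ω := by
    intro q hq hqs
    refine ⟨norm_cylExp_lt.2 (h0.trans_le hq.2.1), norm_cylExp_lt.2 (hq.2.2.trans_lt h1),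
      fun hmem => ?_⟩
    rcases hΓ _ hmem with h | ⟨-, t, ht, htr, h⟩
    · exact hqs h
    · have := hfE h
      rw [hγf t ht, hq.1] at this
      exact htr this.symm
  have hsegball : ∀ q ∈ S, cylExp σ q ∈ segment ℝ a b → cylExp σ q ∈ Metric.ball P v := by
    intro q hq hqs
    rw [← insert_endpoints_openSegment] at hqs
    rcases hqs with h | h | h
    · have := hfE h
      rw [hγf t₁ mt₁, hq.1] at this
      exact absurd this ht₁.2.ne'
    · have := hfE h
      rw [hγf t₂ mt₂, hq.1] at this
      exact absurd this ht₂.1.ne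
    · have := (strictConvex_closedBall ℝ P v).openSegment_subset
        (mem_closedBall_iff_norm.2 ha.le) (mem_closedBall_iff_norm.2 hb.le) hab h
      rwa [interior_closedBall P hv.ne'] at this
  have hballsub : Metric.ball P v ⊆ Metric.ball P v₀ := Metric.ball_subset_ball hvv.le
  have hdiff : ∀ w ∈ Metric.ball P v \ segment ℝ a b, ∃ k : ℤ, sec w - x w = k := by
    intro w hw
    have hwΩ := hballΩ hw
    have hw0 : w ≠ 0 := norm_pos_iff.1 ((norm_nonneg _).trans_lt hwΩ.1)
    obtain ⟨k, hk⟩ := (hsecA w (hballsub hw.1)).exists_int hw0 (hxA w hwΩ)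
    refine ⟨k, mul_left_cancel₀ Real.two_pi_pos.ne' ?_⟩
    linarith
  obtain ⟨n₁, n₂, hn⟩ := exists_two_values_of_chord ha hb hab (n := fun w => round (sec w - x w))
    (continuousOn_round ((hsec.mono (sdiff_subset.trans hballsub)).sub (hx.mono hballΩ)) hdiff)
  replace hn : ∀ w ∈ Metric.ball P v \ segment ℝ a b, sec w - x w = n₁ ∨ sec w - x w = n₂ := by
    intro w hw
    obtain ⟨k, hk⟩ := hdiff w hw
    have := hn w hw
    simp only [hk, round_intCast] at this
    rw [hk]
    exact_mod_cast this
  let Λ : V2 → V2 := fun q => ![x (cylExp σ q) + n₁, q 1]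
  have hΛshift : ∀ n q, Λ (shift n q) = Λ q := fun n q => by simp [Λ, cylExp_shift]
  let T : Set V2 := S ∩ (cylExp σ ⁻¹' segment ℝ a b)ᶜ
  have hxT : ContinuousOn (fun q => x (cylExp σ q)) T :=
    hx.comp (continuous_cylExp σ).continuousOn fun q hq => hSΩ q hq.1 hq.2
  have hΛ : ContinuousOn Λ T := by
    refine continuousOn_pi.2 fun i => ?_
    fin_cases i
    · exact hxT.add continuousOn_const
    · exact (continuous_apply 1).continuousOn
  have hxint : ∀ q ∈ T, ∃ k : ℤ, q 0 = x (cylExp σ q) + k := fun q hq =>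
    exists_int_eq_of_isArg_cylExp (hxA _ (hSΩ q hq.1 hq.2))
  have hS'T : ∀ q ∈ S, v ≤ ‖cylExp σ q - P‖ → q ∈ T := fun q hq hqv =>
    ⟨hq, fun h => absurd (mem_ball_iff_norm.1 (hsegball q hq h)) (not_lt.2 hqv)⟩
  refine ⟨v, hv, Λ, hΛ.mono fun q hq => hS'T q hq.1 hq.2, hΛshift, fun q hq hqv => ?_,
    fun s hs => ?_⟩
  · obtain ⟨k, hk⟩ := hxint q (hS'T q hq hqv)
    refine ⟨n₁ - k, v2_ext ?_ (by simp [Λ])⟩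
    rw [shift_apply_zero, hk]
    simp [Λ]
  by_contra! hcon
  let N : V2 → ℝ := fun q =>
    open Classical in
    if cylExp σ q ∈ Metric.ball P v then q 0 - sec (cylExp σ q)
    else if D (Λ q) < s then q 0 - x (cylExp σ q) - n₁ else q 0 - x (cylExp σ q) - n₂
  have hNin : ∀ q, cylExp σ q ∈ Metric.ball P v → N q = q 0 - sec (cylExp σ q) :=
    fun q hq => if_pos hq
  have hlt : ∀ q ∈ T, D (Λ q) < s → N q = q 0 - x (cylExp σ q) - n₁ := by
    intro q hq hqs
    by_cases hqb : cylExp σ q ∈ Metric.ball P v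
    · rw [hNin q hqb]
      rcases hn _ ⟨hqb, hq.2⟩ with h | h
      · linarith
      · by_cases h12 : n₁ = n₂
        · rw [h12]
          linarith
        · exfalso
          have e : Λ q = shift (n₁ - n₂) ![sec (cylExp σ q), q 1] := by
            refine v2_ext ?_ (by simp [Λ])
            rw [shift_apply_zero]
            simp only [Λ, Matrix.cons_val_zero]
            push_cast
            linarith
          have := hL (n₁ - n₂) (sub_ne_zero.2 h12) ![sec (cylExp σ q), q 1]
          rw [← e] at this
          linarith [hsecD q (hballsub hqb), hs.2]
    · simp only [N, if_neg hqb, if_pos hqs]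
  have hgt : ∀ q ∈ T, s < D (Λ q) → N q = q 0 - x (cylExp σ q) - n₂ := by
    intro q hq hqs
    by_cases hqb : cylExp σ q ∈ Metric.ball P v
    · rw [hNin q hqb]
      rcases hn _ ⟨hqb, hq.2⟩ with h | h
      · exfalso
        have e : Λ q = ![sec (cylExp σ q), q 1] := by
          refine v2_ext ?_ (by simp [Λ])
          simp only [Λ, Matrix.cons_val_zero]
          linarith
        rw [e] at hqs
        linarith [hsecD q (hballsub hqb), hs.1]
      · linarith
    · simp only [N, if_neg hqb, if_neg hqs.not_gt]
  have hNc : ContinuousOn N S := by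
    intro q hq
    by_cases hqb : cylExp σ q ∈ Metric.ball P v
    · have hopen : ∀ᶠ q' in nhds q, cylExp σ q' ∈ Metric.ball P v :=
        (continuous_cylExp σ).continuousAt.eventually (Metric.isOpen_ball.mem_nhds hqb)
      have hc : ContinuousAt (fun q : V2 => q 0 - sec (cylExp σ q)) q := by
        refine (continuous_apply 0).continuousAt.sub ?_
        exact ContinuousAt.comp (g := sec)
          (hsec.continuousAt (Metric.isOpen_ball.mem_nhds (hballsub hqb)))
          (continuous_cylExp σ).continuousAt
      exact (hc.congr (hopen.mono fun q' hq' => (hNin q' hq').symm)).continuousWithinAt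
    · have hqv : v ≤ ‖cylExp σ q - P‖ := not_lt.1 fun h => hqb (mem_ball_iff_norm.2 h)
      have hqT : q ∈ T := hS'T q hq hqv
      have hclosed : IsClosed (segment ℝ a b) := by
        rw [← convexHull_pair]
        exact ((Set.toFinite {a, b}).isCompact_convexHull (𝕜 := ℝ)).isClosed
      have hTn : T ∈ nhdsWithin q S := inter_mem self_mem_nhdsWithin
        (mem_nhdsWithin_of_mem_nhds
          ((hclosed.preimage (continuous_cylExp σ)).isOpen_compl.mem_nhds hqT.2))
      refine ContinuousWithinAt.mono_of_mem_nhdsWithin ?_ hTn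
      have hDΛ : ContinuousWithinAt (fun q => D (Λ q)) T q :=
        (hD.comp_continuousOn hΛ) q hqT
      have hxc : ∀ c : ℝ, ContinuousWithinAt (fun q => q 0 - x (cylExp σ q) - c) T q := fun c =>
        ((continuous_apply 0).continuousWithinAt.sub (hxT q hqT)).sub continuousWithinAt_const
      rcases lt_or_gt_of_ne (hcon q hq hqv) with h | h
      · refine (hxc n₁).congr_of_eventuallyEq ?_ (hlt q hqT h)
        filter_upwards [self_mem_nhdsWithin, hDΛ.eventually (gt_mem_nhds h)] with q' h1 h2
        exact hlt q' h1 h2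
      · refine (hxc n₂).congr_of_eventuallyEq ?_ (hgt q hqT h)
        filter_upwards [self_mem_nhdsWithin, hDΛ.eventually (lt_mem_nhds h)] with q' h1 h2
        exact hgt q' h1 h2
  have hNint : ∀ q ∈ S, ∃ k : ℤ, N q = k := by
    intro q hq
    by_cases hqb : cylExp σ q ∈ Metric.ball P v
    · obtain ⟨k, hk⟩ := exists_int_eq_of_isArg_cylExp (hsecA _ (hballsub hqb))
      exact ⟨k, by rw [hNin q hqb]; linarith⟩
    · have hqv : v ≤ ‖cylExp σ q - P‖ := not_lt.1 fun h => hqb (mem_ball_iff_norm.2 h)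
      obtain ⟨k, hk⟩ := hxint q (hS'T q hq hqv)
      rcases lt_or_gt_of_ne (hcon q hq hqv) with h | h
      · refine ⟨k - n₁, ?_⟩
        rw [hlt q (hS'T q hq hqv) h]
        push_cast
        linarith
      · refine ⟨k - n₂, ?_⟩
        rw [hgt q (hS'T q hq hqv) h]
        push_cast
        linarith
  have hN1 : ∀ q, N (shift 1 q) = N q + 1 := by
    intro q
    by_cases hqb : cylExp σ q ∈ Metric.ball P v
    · rw [hNin q hqb, hNin _ (by rwa [cylExp_shift]), cylExp_shift, shift_apply_zero, Int.cast_one]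
      ring
    · have hqb' : cylExp σ (shift 1 q) ∉ Metric.ball P v := by rwa [cylExp_shift]
      by_cases hqs : D (Λ q) < s
      · have hqs' : D (Λ (shift 1 q)) < s := by rwa [hΛshift]
        simp only [N, if_neg hqb, if_neg hqb', if_pos hqs, if_pos hqs', cylExp_shift,
          shift_apply_zero, Int.cast_one]
        ring
      · have hqs' : ¬ D (Λ (shift 1 q)) < s := by rwa [hΛshift]
        simp only [N, if_neg hqb, if_neg hqb', if_neg hqs, if_neg hqs', cylExp_shift,
          shift_apply_zero, Int.cast_one]
        ring
  let ι : ℝ × ℝ → V2 := fun z => ![z.1, σ * z.2]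
  have hι : Continuous ι := by
    refine continuous_pi fun i => ?_
    fin_cases i
    · exact continuous_fst
    · exact continuous_const.mul continuous_snd
  have hι1 : ∀ z, σ * ι z 1 = z.2 := fun z => by
    simp only [ι, Matrix.cons_val_one, Matrix.cons_val_fin_one]
    rw [← mul_assoc, hσ, one_mul]
  have hιshift : ∀ x y, ι (x + 1, y) = shift 1 (ι (x, y)) := fun x y =>
    v2_ext (by simp [ι]) (by simp [ι])
  refine no_equivariant_index (hf.comp hι) (r := r) (c := y₀) (d := y₁)
    (fun x y => ?_) hy (fun x => hbot _ (hι1 _)) (fun x => htop _ (hι1 _))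
    (N := fun z => round (N (ι z))) ?_ fun x y _ _ => ?_
  · simp only [Function.comp_apply, hιshift, hper]
  · have hmaps : MapsTo ι {z | (f ∘ ι) z = r ∧ z.2 ∈ Icc y₀ y₁} S := fun z hz =>
      ⟨hz.1, by rw [hι1]; exact hz.2.1, by rw [hι1]; exact hz.2.2⟩
    exact (continuousOn_round hNc hNint).comp hι.continuousOn hmaps
  · simp only [hιshift, hN1, round_add_one]

namespace CylMetric

theorem exists_shift_of_cdist_eq_zero (C : CylMetric) {p q : V2} (h : C.cdist p q = 0) :
    ∃ n, p = shift n q := by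
  obtain ⟨Y, hpY, hqY⟩ : ∃ Y, |p 1| ≤ Y ∧ |q 1| ≤ Y := ⟨_, le_max_left _ _, le_max_right _ _⟩
  obtain ⟨m, hm, hle⟩ := C.exists_le_dist Y ((abs_nonneg _).trans hpY)
  have key : ∀ ε : ℝ, 0 < ε → ε ≤ 1 → ‖p - shift (round (p 0 - q 0)) q‖ ≤ ε := by
    intro ε hε hε1
    obtain ⟨n, hn⟩ := C.exists_dist_shift_lt (h ▸ mul_pos hm hε)
    have h1 : min 1 ‖p - shift n q‖ < ε := lt_of_mul_lt_mul_left ((hle _ _ hpY).trans_lt hn) hm.le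
    have h2 : ‖p - shift n q‖ < ε := (min_lt_iff.1 h1).resolve_left hε1.not_gt
    refine (pi_norm_le_iff_of_nonneg hε.le).2 fun i => ?_
    have h3 := (norm_le_pi_norm (p - shift n q) i).trans h2.le
    fin_cases i
    · simp only [Fin.zero_eta, Pi.sub_apply, shift_apply_zero, Real.norm_eq_abs, ← sub_sub] at h3 ⊢
      exact (round_le _ _).trans h3
    · simpa using h3
  refine ⟨round (p 0 - q 0), sub_eq_zero.1 (norm_le_zero_iff.1 ?_)⟩
  refine le_of_forall_pos_le_add fun ε hε => ?_
  rw [zero_add]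
  exact (key (min ε 1) (lt_min hε one_pos) (min_le_right _ _)).trans (min_le_left _ _)

/-- A continuous lift of a compact set is locally isometric for the distances on the cylinder and
on the plane. -/
theorem exists_dist_le_cdist_of_lift (C : CylMetric) {S : Set V2} (hS : IsCompact S) {Λ : V2 → V2}
    (hΛ : ContinuousOn Λ S) (hinv : ∀ n q, Λ (shift n q) = Λ q)
    (hlift : ∀ q ∈ S, ∃ n, Λ q = shift n q) :
    ∃ δ > 0, ∀ p ∈ S, ∀ q ∈ S, C.cdist p q ≤ δ → C.M.dist (Λ p) (Λ q) ≤ C.cdist p q := by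
  have hcd : ∀ p ∈ S, ∀ q ∈ S, C.cdist (Λ p) (Λ q) = C.cdist p q := by
    intro p hp q hq
    obtain ⟨n, hn⟩ := hlift p hp
    obtain ⟨k, hk⟩ := hlift q hq
    rw [hn, hk, C.cdist_shift_left, C.cdist_shift_right]
  obtain ⟨Y, hY⟩ : ∃ Y, ∀ q ∈ S, |Λ q 1| ≤ Y := by
    obtain ⟨Y, hY⟩ := hS.exists_bound_of_continuousOn hΛ
    exact ⟨Y, fun q hq => (norm_le_pi_norm (Λ q) 1).trans (hY q hq)⟩
  rcases S.eq_empty_or_nonempty with rfl | ⟨q₀, hq₀⟩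
  · exact ⟨1, one_pos, by simp⟩
  obtain ⟨m, hm, hle⟩ := C.exists_le_dist Y ((abs_nonneg _).trans (hY q₀ hq₀))
  have hloop : ∀ q ∈ S, ∀ n : ℤ, n ≠ 0 → m ≤ C.M.dist (Λ q) (shift n (Λ q)) := by
    intro q hq n hn
    have := hle (Λ q) (shift n (Λ q)) (hY q hq)
    have h1 : (1 : ℝ) ≤ |(n : ℝ)| := by exact_mod_cast Int.one_le_abs hn
    rwa [norm_sub_shift, min_eq_left h1, mul_one] at this
  obtain ⟨δ', hδ', hsep⟩ : ∃ δ > 0, ∀ p ∈ S, ∀ q ∈ S, m / 3 ≤ C.M.dist (Λ p) (Λ q) →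
      δ ≤ C.cdist p q := by
    have hA := hS.image_of_continuousOn hΛ
    let K : Set (V2 × V2) := ((Λ '' S) ×ˢ (Λ '' S)) ∩ {z | m / 3 ≤ C.M.dist z.1 z.2}
    have hK : IsCompact K := (hA.prod hA).inter_right
      (isClosed_le continuous_const C.continuous_dist)
    rcases K.eq_empty_or_nonempty with h0 | h0
    · refine ⟨1, one_pos, fun p hp q hq h => ?_⟩
      have : (Λ p, Λ q) ∈ K := ⟨⟨mem_image_of_mem _ hp, mem_image_of_mem _ hq⟩, h⟩
      simp [h0] at this
    obtain ⟨⟨_, _⟩, ⟨⟨⟨p₁, hp₁, rfl⟩, ⟨q₁, hq₁, rfl⟩⟩, hz⟩, hmin⟩ :=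
      hK.exists_isMinOn h0 C.continuous_cdist.continuousOn
    refine ⟨C.cdist (Λ p₁) (Λ q₁), (C.cdist_nonneg _ _).lt_of_ne fun h => ?_,
      fun p hp q hq h => ?_⟩
    · rw [hcd p₁ hp₁ q₁ hq₁] at h
      obtain ⟨n, hn⟩ := C.exists_shift_of_cdist_eq_zero h.symm
      have h2 : m / 3 ≤ C.M.dist (Λ p₁) (Λ q₁) := hz
      rw [hn, hinv, C.M.dist_self] at h2
      linarith
    · rw [← hcd p hp q hq]
      exact isMinOn_iff.1 hmin (Λ p, Λ q) ⟨⟨mem_image_of_mem _ hp, mem_image_of_mem _ hq⟩, h⟩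
  refine ⟨min (m / 3) (δ' / 2), lt_min (by linarith) (by linarith), fun p hp q hq h => ?_⟩
  have hpq : C.M.dist (Λ p) (Λ q) < m / 3 := by
    by_contra! hge
    linarith [hsep p hp q hq hge, min_le_right (m / 3) (δ' / 2)]
  rw [← hcd p hp q hq] at h ⊢
  by_contra! hlt
  obtain ⟨n, hn⟩ := C.exists_dist_shift_lt hlt
  have hn0 : n ≠ 0 := by
    rintro rfl
    rw [shift_zero] at hn
    exact lt_irrefl _ hn
  have h1 := hloop q hq n hn0
  have h2 := C.M.dist_triangle (Λ q) (Λ p) (shift n (Λ q))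
  rw [C.M.dist_comm (Λ q) (Λ p)] at h2
  linarith

/-- The one-dimensional Hausdorff measure is bounded below by the length of an interval covered by a
function that is locally `1`-Lipschitz. -/
theorem ofReal_sub_le_cH1 (C : CylMetric) {E S : Set V2} (hSE : S ⊆ E ∩ strip) {h : V2 → ℝ}
    {δ : ℝ} (hδ : 0 < δ)
    (hh : ∀ p ∈ S, ∀ q ∈ S, C.cdist p q ≤ δ → |h p - h q| ≤ C.cdist p q) {a b : ℝ}
    (hI : Ioo a b ⊆ h '' S) : ENNReal.ofReal (b - a) ≤ C.cH1 E := by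
  refine le_trans ?_ (le_iSup₂ (α := ℝ≥0∞) δ hδ)
  refine le_iInf fun U => le_iInf fun hcov => le_iInf fun hU => ?_
  have hdiam : ∀ n, ∀ p ∈ U n, ∀ q ∈ U n, ENNReal.ofReal (C.cdist p q) ≤ C.ediamC (U n) :=
    fun n p hp q hq => (le_iSup₂ (α := ℝ≥0∞)
      (f := fun q (_ : q ∈ U n) => ENNReal.ofReal (C.cdist p q)) q hq).trans
      (le_iSup₂ (α := ℝ≥0∞)
        (f := fun p (_ : p ∈ U n) => ⨆ q ∈ U n, ENNReal.ofReal (C.cdist p q)) p hp)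
  have hsub : Ioo a b ⊆ ⋃ n, h '' (S ∩ U n) := by
    intro s hs
    obtain ⟨q, hq, rfl⟩ := hI hs
    obtain ⟨n, hn⟩ := mem_iUnion.1 (hcov (hSE hq))
    exact mem_iUnion.2 ⟨n, mem_image_of_mem _ ⟨hq, hn⟩⟩
  calc ENNReal.ofReal (b - a) = volume (Ioo a b) := Real.volume_Ioo.symm
    _ ≤ ∑' n, volume (h '' (S ∩ U n)) := (measure_mono hsub).trans (measure_iUnion_le _)
    _ ≤ ∑' n, C.ediamC (U n) := ENNReal.tsum_le_tsum fun n => ?_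
  refine (Real.volume_le_diam _).trans (Metric.ediam_le ?_)
  rintro _ ⟨p, ⟨hp, hpU⟩, rfl⟩ _ ⟨q, ⟨hq, hqU⟩, rfl⟩
  have h1 := hdiam n p hpU q hqU
  have h2 : C.cdist p q ≤ δ := (ENNReal.ofReal_le_ofReal_iff hδ.le).1 (h1.trans (hU n))
  rw [edist_dist, Real.dist_eq]
  exact (ENNReal.ofReal_le_ofReal (hh p hp q hq h2)).trans h1

theorem continuousOn_cylExp_of_cdist_eq (C : CylMetric) (σ : ℝ) {γ : ℝ → V2} {I : Set ℝ}
    (hγ : ∀ s ∈ I, ∀ t ∈ I, C.cdist (γ s) (γ t) = |s - t|) :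
    ContinuousOn (fun t => cylExp σ (γ t)) I := by
  intro s hs
  obtain ⟨m, hm, hle⟩ := C.exists_le_dist |γ s 1| (abs_nonneg _)
  refine Metric.continuousWithinAt_iff.2 fun ε hε => ?_
  obtain ⟨η, hη, hc⟩ := Metric.continuousAt_iff.1 (continuous_cylExp σ).continuousAt ε hε
  refine ⟨m * min 1 η, mul_pos hm (lt_min one_pos hη), fun t ht hts => ?_⟩
  rw [Real.dist_eq, abs_sub_comm, ← hγ s hs t ht] at hts
  obtain ⟨n, hn⟩ := C.exists_dist_shift_lt hts
  have h1 := lt_of_mul_lt_mul_left ((hle _ _ le_rfl).trans_lt hn) hm.le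
  have h2 : ‖γ s - shift n (γ t)‖ < η := by
    by_contra! h
    exact h1.not_ge (min_le_min_left 1 h)
  rw [← cylExp_shift σ n (γ t)]
  exact hc (by rwa [dist_comm, dist_eq_norm])

theorem loopLen_le_cH1_of_ray (C : CylMetric) (hC : C.Complete) {σ : ℝ} (hσ : σ * σ = 1)
    {γ : ℝ → V2} (hγ : C.IsRay γ) (hlim : Tendsto (fun t => σ * γ t 1) atTop atTop)
    {U : Set V2} {c : ℝ} (hU : ∀ q : V2, c < σ * q 1 → q ∈ U) :
    ∀ᶠ r : ℝ in atTop, ENNReal.ofReal (C.loopLen (γ r)) ≤ C.cH1 (U ∩ C.csphere (γ 0) r) := by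
  have habs : ∀ y : ℝ, |σ * y| = |y| := by
    rcases mul_self_eq_one_iff.1 hσ with rfl | rfl <;> simp
  let f : V2 → ℝ := fun q => C.cdist (γ 0) q
  have hf : Continuous f := C.continuous_cdist.comp (continuous_const.prodMk continuous_id)
  have hper : ∀ n q, f (shift n q) = f q := fun n q => C.cdist_shift_right _ _ _
  let y₀ := max c (σ * γ 0 1) + 1
  obtain ⟨F, hF⟩ : ∃ F, ∀ q : V2, σ * q 1 = y₀ → f q ≤ F := by
    obtain ⟨F, hF⟩ := (isCompact_periodBox |y₀|).exists_bound_of_continuousOn hf.continuousOn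
    refine ⟨F, fun q hq => ?_⟩
    rw [← hper (-⌊q 0⌋) q]
    exact (le_abs_self _).trans (hF _ (shift_floor_mem_periodBox (by rw [← hq, habs])))
  filter_upwards [eventually_gt_atTop (max F 0), hlim.eventually_ge_atTop y₀] with r hr hry
  have hfγ : ∀ t, 0 ≤ t → f (γ t) = t := fun t ht => by
    rw [show f (γ t) = |0 - t| from hγ 0 le_rfl t ht, zero_sub, abs_neg, abs_of_nonneg ht]
  have hr0 : 0 ≤ r := (le_max_right _ _).trans hr.le
  obtain ⟨Y, hY⟩ := C.exists_height_bound hC (γ 0) r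
  let y₁ := max Y (max y₀ (σ * γ r 1)) + 1
  have hy₁ : Y < y₁ ∧ y₀ < y₁ ∧ σ * γ r 1 < y₁ :=
    ⟨(le_max_left _ _).trans_lt (lt_add_one _),
      ((le_max_left _ _).trans (le_max_right _ _)).trans_lt (lt_add_one _),
      ((le_max_right _ _).trans (le_max_right _ _)).trans_lt (lt_add_one _)⟩
  obtain ⟨R, hR, hRr⟩ := ((hlim.eventually_gt_atTop y₁).and (eventually_ge_atTop r)).exists
  let D : V2 → ℝ := fun q => C.M.dist (γ r) q
  have hD : Continuous D := C.continuous_dist.comp (continuous_const.prodMk continuous_id)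
  have key : ∀ ε : ℝ, 0 < ε →
      ENNReal.ofReal (C.loopLen (γ r) - ε - ε) ≤ C.cH1 (U ∩ C.csphere (γ 0) r) := by
    intro ε hε
    obtain ⟨v, -, Λ, hΛ, hinv, hlift, hsurj⟩ := exists_lift_of_level_set hσ hf hper (r := r)
      hy₁.2.1 (fun q hq => (hF q hq).trans_lt ((le_max_left _ _).trans_lt hr))
      (fun q hq => by
        by_contra! h
        exact ((le_abs_self _).trans (habs (q 1) ▸ hY q h)).not_gt (hq ▸ hy₁.1))
      ⟨hr0, hRr⟩ (C.continuousOn_cylExp_of_cdist_eq σ fun s hs t ht => hγ s hs.1 t ht.1)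
      (fun t ht => hfγ t ht.1) ((le_max_right _ _).trans_lt (lt_add_one _)) hR hry hy₁.2.2.le
      hD (C.M.dist_self _) (L := C.loopLen (γ r)) hε (fun n hn q => by
        have h1 := C.loopLen_le (γ r) hn
        have h2 := C.M.dist_triangle (γ r) (shift n q) (shift n (γ r))
        rw [C.dist_shift_shift, C.M.dist_comm q] at h2
        exact sub_le_iff_le_add.2 (h1.trans h2))
    let S : Set V2 := {q | (f q = r ∧ y₀ ≤ σ * q 1 ∧ σ * q 1 ≤ y₁) ∧
      v ≤ ‖cylExp σ q - cylExp σ (γ r)‖}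
    have hσq : Continuous fun q : V2 => σ * q 1 := continuous_const.mul (continuous_apply 1)
    have hS : IsClosed S :=
      ((isClosed_eq hf continuous_const).inter ((isClosed_le continuous_const hσq).inter
        (isClosed_le hσq continuous_const))).inter
        (isClosed_le continuous_const ((continuous_cylExp σ).sub continuous_const).norm)
    have hSbox : S ∩ strip ⊆ S ∩ periodBox (max |y₀| |y₁|) := by
      rintro q ⟨hq, hqs⟩
      refine ⟨hq, mem_periodBox.2 ⟨⟨hqs.1, hqs.2.le⟩, ?_⟩⟩
      rw [← habs]
      exact abs_le_max_abs_abs hq.1.2.1 hq.1.2.2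
    obtain ⟨δ, hδ, hloc⟩ := C.exists_dist_le_cdist_of_lift
      ((isCompact_periodBox (max |y₀| |y₁|)).inter_left hS) (hΛ.mono inter_subset_left) hinv
      fun q hq => hlift q hq.1.1 hq.1.2
    refine C.ofReal_sub_le_cH1 (S := S ∩ strip) (h := fun q => D (Λ q)) ?_ hδ ?_ ?_
    · rintro q ⟨hq, hqs⟩
      refine ⟨⟨hU q ?_, hq.1.1⟩, hqs⟩
      exact ((le_max_left _ _).trans_lt (lt_add_one _)).trans_le hq.1.2.1
    · intro p hp q hq h
      refine le_trans ?_ (hloc p (hSbox hp) q (hSbox hq) h)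
      have h1 := C.M.dist_triangle (γ r) (Λ p) (Λ q)
      have h2 := C.M.dist_triangle (γ r) (Λ q) (Λ p)
      rw [C.M.dist_comm (Λ q)] at h2
      exact abs_sub_le_iff.2 ⟨sub_le_iff_le_add'.2 h2, sub_le_iff_le_add'.2 h1⟩
    · intro s hs
      obtain ⟨q, hq, hqv, hqs⟩ := hsurj s hs
      refine ⟨shift (-⌊q 0⌋) q, ⟨⟨⟨(hper _ _).trans hq.1, ?_⟩, ?_⟩, ?_⟩, ?_⟩
      · simpa using hq.2
      · rwa [cylExp_shift]
      · rw [strip, mem_ofPred_eq, shift_apply_zero, Int.cast_neg, ← sub_eq_add_neg]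
        exact ⟨Int.fract_nonneg _, Int.fract_lt_one _⟩
      · simpa only [hinv] using hqs
  generalize C.loopLen (γ r) = L at key ⊢
  refine ENNReal.le_of_forall_pos_le_add fun ε hε _ => ?_
  have hε' : (0 : ℝ) < ε / 2 := by positivity
  have hsum : L = L - ε / 2 - ε / 2 + ε := by ring
  calc ENNReal.ofReal L ≤ ENNReal.ofReal (L - ε / 2 - ε / 2) + ENNReal.ofReal ε :=
        (congrArg ENNReal.ofReal hsum).trans_le ENNReal.ofReal_add_le
    _ ≤ C.cH1 (U ∩ C.csphere (γ 0) r) + ε := by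
        rw [ENNReal.ofReal_coe_nnreal]
        exact add_le_add (key _ hε') le_rfl

end CylMetric

/-- **Lemma 5.** If `γ` is a ray in a complete cylinder without conjugate points
converging to an end `ℰ` and `U` is a neighborhood of `ℰ`, then
`l(γ(r)) ≤ H¹(U ∩ ∂B(γ(0), r))` for all sufficiently large `r`. -/
theorem loop_length_le_sphere_measure (C : CylMetric)
    (hcomp : C.Complete) (hconj : C.M.NoConjugatePoints)
    (pos : Bool) (γ : ℝ → V2) (hray : C.RayToEnd γ pos)
    (U : Set V2) (hU : CylMetric.EndNbhd U pos) :
    ∀ᶠ r : ℝ in atTop,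
      ENNReal.ofReal (C.loopLen (γ r)) ≤ C.cH1 (U ∩ C.csphere (γ 0) r) := by
  obtain ⟨hγ, hlim⟩ := hray
  obtain ⟨-, c, -, hU⟩ := hU
  cases pos
  · refine C.loopLen_le_cH1_of_ray hcomp (σ := -1) (by norm_num) hγ (c := c) ?_ fun q hq => hU q ?_
    · simpa using hlim
    · simp only [Bool.false_eq_true, if_false]
      linarith
  · refine C.loopLen_le_cH1_of_ray hcomp (σ := 1) (by norm_num) hγ (c := c) ?_ fun q hq => hU q ?_
    · simpa using hlim
    · simpa using hq
end

section
/- Let (X,d) be a metric space, p ∈ X, S ⊆ X, and T > 0. If for every t ∈ (0,T) the set S ∩ ∂B(p,t) contains at least two points, then H¹(S) ≥ 2T. -/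
open MeasureTheory Filter Set Real
open scoped ENNReal NNReal

/-- Let `f` be a `1`-Lipschitz function. If for every `t ∈ A` the set `S` contains two points at
distance more than `r` at which `f` takes the value `t`, then the one-dimensional Hausdorff measure
of `S` is at least twice the outer Lebesgue measure of `A`. -/
theorem two_mul_volume_le_hausdorffMeasure_of_separated
    {X : Type*} [EMetricSpace X] [MeasurableSpace X] [BorelSpace X]
    {f : X → ℝ} (hf : LipschitzWith 1 f) {S : Set X} {A : Set ℝ} {r : ℝ≥0∞} (hr : 0 < r)
    (h : ∀ t ∈ A, ∃ x ∈ S, ∃ y ∈ S, f x = t ∧ f y = t ∧ r < edist x y) :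
    2 * volume A ≤ μH[1] S := by
  rw [Measure.hausdorffMeasure_apply]
  refine le_iSup₂_of_le r hr (le_iInf₂ fun U hU => le_iInf fun hd => ?_)
  let F : ℝ → ℝ≥0∞ := fun t => ∑' n, (closure (f '' U n)).indicator 1 t
  have hmeas (n : ℕ) : Measurable ((closure (f '' U n)).indicator (1 : ℝ → ℝ≥0∞)) :=
    measurable_one.indicator isClosed_closure.measurableSet
  have hF (t : ℝ) (ht : t ∈ A) : 2 ≤ F t := by
    obtain ⟨x, hx, y, hy, hxt, hyt, hxy⟩ := h t ht
    obtain ⟨i, hi⟩ := mem_iUnion.1 (hU hx)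
    obtain ⟨j, hj⟩ := mem_iUnion.1 (hU hy)
    have hij : i ≠ j := by
      rintro rfl
      exact hxy.not_ge ((Metric.edist_le_ediam_of_mem hi hj).trans (hd i))
    have hti : t ∈ closure (f '' U i) := subset_closure ⟨x, hi, hxt⟩
    have htj : t ∈ closure (f '' U j) := subset_closure ⟨y, hj, hyt⟩
    calc
      (2 : ℝ≥0∞) = ∑ n ∈ {i, j}, (closure (f '' U n)).indicator 1 t := by
        rw [Finset.sum_pair hij, indicator_of_mem hti, indicator_of_mem htj]
        exact one_add_one_eq_two.symm
      _ ≤ F t := ENNReal.sum_le_tsum _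
  calc
    2 * volume A ≤ 2 * volume {t | 2 ≤ F t} := by
      gcongr
      exact hF
    _ ≤ ∫⁻ t, F t := mul_meas_ge_le_lintegral (Measurable.tsum hmeas) 2
    _ = ∑' n, volume (closure (f '' U n)) := by
      rw [lintegral_tsum fun n => (hmeas n).aemeasurable]
      simp_rw [lintegral_indicator_one isClosed_closure.measurableSet]
    _ ≤ _ := by
      refine ENNReal.tsum_le_tsum fun n => ?_
      rcases (U n).eq_empty_or_nonempty with hn | hn
      · simp [hn]
      · refine le_iSup_of_le hn ?_
        calc
          volume (closure (f '' U n)) ≤ Metric.ediam (closure (f '' U n)) :=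
            Real.volume_le_diam _
          _ = Metric.ediam (f '' U n) := Metric.ediam_closure _
          _ ≤ Metric.ediam (U n) ^ (1 : ℝ) := by
            simpa using hf.ediam_image_le (U n)

/-- **Two-point spheres give length.** In a metric space, if for every
`t ∈ (0,T)` the set `S ∩ ∂B(p,t)` contains at least two points, then
`H¹(S) ≥ 2T`. -/
theorem hausdorff_ge_of_two_points_on_spheres
    {X : Type*} [MetricSpace X] [MeasurableSpace X] [BorelSpace X]
    (p : X) (S : Set X) (T : ℝ) (hT : 0 < T)
    (h : ∀ t ∈ Set.Ioo (0:ℝ) T,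
      ∃ x ∈ S ∩ Metric.sphere p t, ∃ y ∈ S ∩ Metric.sphere p t, x ≠ y) :
    ENNReal.ofReal (2 * T) ≤ μH[1] S := by
  let A : ℕ → Set ℝ := fun n =>
    {t | ∃ x ∈ S, ∃ y ∈ S, dist x p = t ∧ dist y p = t ∧ ((n : ℝ≥0∞) + 1)⁻¹ < edist x y}
  have hA : Monotone A := by
    rintro m n hmn t ⟨x, hx, y, hy, hxt, hyt, hxy⟩
    refine ⟨x, hx, y, hy, hxt, hyt, lt_of_le_of_lt ?_ hxy⟩
    gcongr
  have hcover : Ioo 0 T ⊆ ⋃ n, A n := by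
    intro t ht
    obtain ⟨x, ⟨hx, hxt⟩, y, ⟨hy, hyt⟩, hxy⟩ := h t ht
    obtain ⟨n, hn⟩ := ENNReal.exists_inv_nat_lt (edist_pos.2 hxy).ne'
    refine mem_iUnion.2 ⟨n, x, hx, y, hy, hxt, hyt, lt_of_le_of_lt ?_ hn⟩
    gcongr
    exact le_self_add
  calc
    ENNReal.ofReal (2 * T) = 2 * volume (Ioo 0 T) := by
      rw [Real.volume_Ioo, sub_zero, ENNReal.ofReal_mul zero_le_two, ENNReal.ofReal_ofNat]
    _ ≤ 2 * volume (⋃ n, A n) := by gcongr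
    _ = ⨆ n, 2 * volume (A n) := by rw [hA.measure_iUnion, ENNReal.mul_iSup]
    _ ≤ μH[1] S := iSup_le fun n =>
      two_mul_volume_le_hausdorffMeasure_of_separated (LipschitzWith.dist_left p)
        (ENNReal.inv_pos.2 (by finiteness)) fun _ ht => ht
end
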